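/- arXiv:0710.1530 — 9 statements merged into one kernel-verified Lean document; each statement's English description precedes it below -/
import Mathlib

section
/- Let A and B be n×n complex matrices. Suppose A is range Hermitian (i.e., the column space of A equals the column space of A*) and B is normal. Then ABA = A²B if and only if AB = BA. -/
open Matrix

/-- A Hermitian matrix has a Hermitian inner inverse that commutes with it. -/
lemma Matrix.IsHermitian.exists_commuting_inner_inverse {n : ℕ}
    {H : Matrix (Fin n) (Fin n) ℂ} (hH : H.IsHermitian) :
    ∃ R : Matrix (Fin n) (Fin n) ℂ, Rᴴ = R ∧ R * H = H * R ∧ H * R * H = H := by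
  set φ := Unitary.conjStarAlgAut ℂ (Matrix (Fin n) (Fin n) ℂ) hH.eigenvectorUnitary with hφ
  set d : Fin n → ℂ := fun i => (hH.eigenvalues i : ℂ) with hd
  have hs : H = φ (diagonal d) := hH.spectral_theorem
  refine ⟨φ (diagonal fun i => (d i)⁻¹), ?_, ?_, ?_⟩
  · rw [← star_eq_conjTranspose, ← map_star, star_eq_conjTranspose, diagonal_conjTranspose]
    congr 2
    ext i
    simp [hd]
  · rw [hs, ← map_mul, ← map_mul, diagonal_mul_diagonal, diagonal_mul_diagonal]
    simp only [mul_comm]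
  · rw [hs, ← map_mul, ← map_mul, diagonal_mul_diagonal, diagonal_mul_diagonal]
    simp only [mul_inv_mul_cancel]

open scoped ComplexOrder in
/-- Every matrix `A` has a Hermitian idempotent `Q`, a left multiple of `A`, with `A * Q = A`:
the orthogonal projection onto the range of `Aᴴ`. -/
lemma Matrix.exists_support_projection {n : ℕ} (A : Matrix (Fin n) (Fin n) ℂ) :
    ∃ Q S : Matrix (Fin n) (Fin n) ℂ, Qᴴ = Q ∧ Q * Q = Q ∧ A * Q = A ∧ Q = S * A := by
  obtain ⟨R, hR, hc, hi⟩ :=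
    (isHermitian_conjTranspose_mul_self A).exists_commuting_inner_inverse
  refine ⟨R * (Aᴴ * A), R * Aᴴ, ?_, ?_, ?_, by simp only [Matrix.mul_assoc]⟩
  · rw [conjTranspose_mul, (isHermitian_conjTranspose_mul_self A).eq, hR, hc]
  · rw [Matrix.mul_assoc, ← Matrix.mul_assoc (Aᴴ * A), hi]
  · have h : Aᴴ * A * (R * (Aᴴ * A) - 1) = 0 := by
      rw [Matrix.mul_sub, ← Matrix.mul_assoc, hi, Matrix.mul_one, sub_self]
    rw [conjTranspose_mul_self_mul_eq_zero, Matrix.mul_sub, Matrix.mul_one, sub_eq_zero] at h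
    exact h

/-- If the range of `A` is contained in the range of `C`, then `A` is a right multiple of `C`. -/
lemma Matrix.exists_eq_mul_of_range_le {n : ℕ} {A C : Matrix (Fin n) (Fin n) ℂ}
    (h : LinearMap.range A.mulVecLin ≤ LinearMap.range C.mulVecLin) :
    ∃ Y : Matrix (Fin n) (Fin n) ℂ, A = C * Y := by
  have hcol : ∀ j, ∃ y, C *ᵥ y = A.col j := fun j => by
    obtain ⟨y, hy⟩ := h ⟨Pi.single j 1, rfl⟩
    exact ⟨y, by simpa using hy⟩
  choose y hy using hcol
  refine ⟨(of y)ᵀ, ?_⟩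
  ext i j
  exact (congrFun (hy j) i).symm

open scoped ComplexOrder in
/-- If the range of a Hermitian idempotent `P` is invariant under a normal matrix `B`,
then so is its orthogonal complement. -/
lemma Matrix.proj_mul_mul_compl_eq_zero_of_normal {n : ℕ} {B P : Matrix (Fin n) (Fin n) ℂ}
    (hB : Bᴴ * B = B * Bᴴ) (hP : Pᴴ = P) (hPP : P * P = P) (h : (1 - P) * B * P = 0) :
    P * B * (1 - P) = 0 := by
  have hBP : P * B * P = B * P := by
    rw [Matrix.sub_mul, Matrix.sub_mul, Matrix.one_mul, sub_eq_zero] at h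
    exact h.symm
  have hBP' : P * Bᴴ * P = P * Bᴴ := by
    simpa [conjTranspose_mul, hP, Matrix.mul_assoc] using congrArg conjTranspose hBP
  rw [← trace_mul_conjTranspose_self_eq_zero_iff]
  have hQ : (1 - P) * (1 - P) = 1 - P := by noncomm_ring [hPP]
  have e : P * B * (1 - P) * (P * B * (1 - P))ᴴ = P * B * Bᴴ * P - P * B * P * Bᴴ * P := by
    simp only [conjTranspose_mul, conjTranspose_sub, conjTranspose_one, hP]
    calc _ = P * B * ((1 - P) * (1 - P)) * Bᴴ * P := by simp only [Matrix.mul_assoc]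
      _ = _ := by rw [hQ]; noncomm_ring
  have e1 : P * B * Bᴴ * P = (P * Bᴴ) * (B * P) := by
    rw [Matrix.mul_assoc P B, ← hB]; simp only [Matrix.mul_assoc]
  have e2 : P * B * P * Bᴴ * P = (B * P) * (P * Bᴴ) := by
    rw [hBP, ← hBP', ← Matrix.mul_assoc, ← Matrix.mul_assoc, Matrix.mul_assoc B P P, hPP]
  rw [e, trace_sub, e1, e2, trace_mul_comm, sub_self]

/-- If `A` is range Hermitian (the ranges of `A` and `Aᴴ` coincide) and `B` is normal,
then `A * B * A = A² * B` if and only if `A * B = B * A`. -/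
theorem stmt_2 {n : ℕ} (A B : Matrix (Fin n) (Fin n) ℂ)
    (hA : LinearMap.range A.mulVecLin = LinearMap.range Aᴴ.mulVecLin)
    (hB : Bᴴ * B = B * Bᴴ) :
    A * B * A = A * A * B ↔ A * B = B * A := by
  refine ⟨fun h => ?_, fun h => by rw [Matrix.mul_assoc, ← h, Matrix.mul_assoc]⟩
  obtain ⟨Y, hY⟩ := exists_eq_mul_of_range_le hA.le
  obtain ⟨Q, S, hQ, hQQ, hAQ, hS⟩ := exists_support_projection A
  have hQA : Q * A = A := by
    have hQA' : Q * Aᴴ = Aᴴ := by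
      simpa [conjTranspose_mul, hQ] using congrArg conjTranspose hAQ
    rw [hY, ← Matrix.mul_assoc, hQA']
  have hker : ∀ M : Matrix (Fin n) (Fin n) ℂ, A * M = 0 → Q * M = 0 := fun M hM => by
    rw [hS, Matrix.mul_assoc, hM, Matrix.mul_zero]
  have hAP : A * (1 - Q) = 0 := by rw [Matrix.mul_sub, hAQ, Matrix.mul_one, sub_self]
  have hABP : A * (B * (1 - Q)) = 0 := by
    have h0 : A * (A * (B * (1 - Q))) = 0 := by
      rw [← Matrix.mul_assoc, ← Matrix.mul_assoc, ← h, Matrix.mul_assoc, hAP, Matrix.mul_zero]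
    have h1 := hker _ h0
    rwa [← Matrix.mul_assoc, hQA] at h1
  have hQBP : Q * B * (1 - Q) = 0 := by rw [Matrix.mul_assoc, hker _ hABP]
  have hPBQ : (1 - Q) * B * Q = 0 := by
    have := proj_mul_mul_compl_eq_zero_of_normal (P := 1 - Q) hB (by simp [hQ])
      (by noncomm_ring [hQQ]) (by rwa [sub_sub_cancel])
    rwa [sub_sub_cancel] at this
  have hcomm : Q * B = B * Q := by
    have h1 : Q * B = Q * B * Q := by
      rwa [Matrix.mul_sub, Matrix.mul_one, sub_eq_zero] at hQBP
    have h2 : B * Q = Q * B * Q := by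
      rwa [Matrix.sub_mul, Matrix.sub_mul, Matrix.one_mul, sub_eq_zero] at hPBQ
    rw [h1, h2]
  calc A * B = Q * (A * B) := by rw [← Matrix.mul_assoc, hQA]
    _ = Q * (B * A) := by
      rw [← sub_eq_zero, ← Matrix.mul_sub]
      apply hker
      rw [Matrix.mul_sub, ← Matrix.mul_assoc, ← Matrix.mul_assoc, h, sub_self]
    _ = B * A := by rw [← Matrix.mul_assoc, hcomm, Matrix.mul_assoc, hQA]
end

section
/- Let A be an n×n complex matrix. Then conj(A)·A is normal if and only if A·conj(A)·Aᵀ = Aᵀ·conj(A)·A. If A is nonsingular, these conditions are also equivalent to the cosquare A⁻ᵀA being normal. -/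
open Matrix

open scoped Matrix.Norms.L2Operator in
/-- The Fuglede-Putnam theorem for complex matrices. -/
theorem Matrix.mul_conjTranspose_eq_of_mul_eq_of_normal {n : Type*} [Fintype n]
    {N M X : Matrix n n ℂ} (hN : Nᴴ * N = N * Nᴴ) (hM : Mᴴ * M = M * Mᴴ) (h : X * N = M * X) :
    X * Nᴴ = Mᴴ * X := by
  classical exact (SemiconjBy.star_right ⟨hN⟩ ⟨hM⟩ h).eq

/-- The inverse transpose of a normal matrix is normal. -/
theorem Matrix.transpose_inv_normal {n : Type*} [Fintype n] [DecidableEq n] {S : Matrix n n ℂ}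
    (hS : Sᴴ * S = S * Sᴴ) : (S⁻¹)ᵀᴴ * (S⁻¹)ᵀ = (S⁻¹)ᵀ * (S⁻¹)ᵀᴴ := by
  have h := congrArg (fun X : Matrix n n ℂ => (X⁻¹)ᵀ) hS
  simp only [mul_inv_rev, transpose_mul, ← conjTranspose_nonsing_inv] at h
  exact h

/-- `conj(A)·A` is normal iff `A·conj(A)·Aᵀ = Aᵀ·conj(A)·A`. -/
theorem Matrix.conj_mul_self_normal_iff {n : Type*} [Fintype n] (A : Matrix n n ℂ) :
    ((A.map (starRingEnd ℂ) * A)ᴴ * (A.map (starRingEnd ℂ) * A) =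
        (A.map (starRingEnd ℂ) * A) * (A.map (starRingEnd ℂ) * A)ᴴ) ↔
      A * A.map (starRingEnd ℂ) * Aᵀ = Aᵀ * A.map (starRingEnd ℂ) * A := by
  obtain ⟨B, hB⟩ : ∃ B, B = A.map (starRingEnd ℂ) := ⟨_, rfl⟩
  have hBt : Bᵀ = Aᴴ := by subst hB; rfl
  have hBh : Bᴴ = Aᵀ := by subst hB; ext; simp
  have hAth : Aᵀᴴ = B := by subst hB; rfl
  have hAht : Aᴴᵀ = B := by subst hB; rfl
  rw [← hB]
  constructor
  · intro h
    have hM : (A * B)ᴴ * (A * B) = (A * B) * (A * B)ᴴ := by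
      have := congrArg (fun X => Xᴴᵀ) h
      simpa [hBt, hBh, hAth, hAht] using this
    have key := mul_conjTranspose_eq_of_mul_eq_of_normal h hM (Matrix.mul_assoc A B A).symm
    simpa [hBt, hBh, hAth, hAht, Matrix.mul_assoc] using congrArg transpose key
  · intro h
    have h1 : A * Aᴴ * Aᵀ = Aᵀ * Aᴴ * A := by
      simpa [hBt, Matrix.mul_assoc] using congrArg transpose h
    have h2 : B * Aᵀ * Aᴴ = Aᴴ * Aᵀ * B := by
      simpa [hBh, hAth, Matrix.mul_assoc] using congrArg conjTranspose h
    rw [conjTranspose_mul, hBh, ← Matrix.mul_assoc, ← h2, Matrix.mul_assoc, Matrix.mul_assoc,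
      ← Matrix.mul_assoc Aᵀ, ← h1]
    simp only [Matrix.mul_assoc]

/-- The cosquare of a nonsingular `A` is normal iff `A·conj(A)·Aᵀ = Aᵀ·conj(A)·A`. -/
theorem Matrix.cosquare_normal_iff {n : Type*} [Fintype n] [DecidableEq n] (A : Matrix n n ℂ)
    (hA : IsUnit A.det) :
    ((A⁻¹)ᵀ * A)ᴴ * ((A⁻¹)ᵀ * A) = ((A⁻¹)ᵀ * A) * ((A⁻¹)ᵀ * A)ᴴ ↔
      A * A.map (starRingEnd ℂ) * Aᵀ = Aᵀ * A.map (starRingEnd ℂ) * A := by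
  obtain ⟨B, hB⟩ : ∃ B, B = A.map (starRingEnd ℂ) := ⟨_, rfl⟩
  have hBt : Bᵀ = Aᴴ := by subst hB; rfl
  have hBh : Bᴴ = Aᵀ := by subst hB; ext; simp
  have hAth : Aᵀᴴ = B := by subst hB; rfl
  have hT : IsUnit Aᵀ.det := by rwa [det_transpose]
  have hBu : IsUnit B.det := by
    rw [← hAth, det_conjTranspose]; exact hT.star
  rw [← hB, transpose_nonsing_inv]
  have hS : (Aᵀ⁻¹ * A)ᴴ = Aᴴ * B⁻¹ := by
    rw [conjTranspose_mul, conjTranspose_nonsing_inv, hAth]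
  constructor
  · intro h
    have hinv : ((Aᵀ⁻¹ * A)⁻¹)ᵀ = A * Aᵀ⁻¹ := by
      rw [mul_inv_rev, nonsing_inv_nonsing_inv _ hT, transpose_mul, transpose_transpose,
        transpose_nonsing_inv]
    have hM := transpose_inv_normal h
    rw [hinv] at hM
    have hX : Aᵀ * (Aᵀ⁻¹ * A) = A * Aᵀ⁻¹ * Aᵀ := by
      rw [mul_nonsing_inv_cancel_left _ _ hT, nonsing_inv_mul_cancel_right _ _ hT]
    have key := mul_conjTranspose_eq_of_mul_eq_of_normal h hM hX
    rw [hS, conjTranspose_mul, conjTranspose_nonsing_inv, hAth] at key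
    have h2 : B * Aᵀ * Aᴴ = Aᴴ * Aᵀ * B := by
      have := congrArg (fun X => B * X * B) key
      simpa only [Matrix.mul_assoc, mul_nonsing_inv_cancel_left _ _ hBu,
        nonsing_inv_mul _ hBu, Matrix.mul_one] using this
    simpa [hBh, hAth, Matrix.mul_assoc] using congrArg conjTranspose h2
  · intro h
    have h1 : A * Aᴴ * Aᵀ = Aᵀ * Aᴴ * A := by
      simpa [hBt, Matrix.mul_assoc] using congrArg transpose h
    have e1 : Aᵀ⁻¹ * A * B = B * A * Aᵀ⁻¹ := by
      have := congrArg (fun X => Aᵀ⁻¹ * X * Aᵀ⁻¹) h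
      simpa only [Matrix.mul_assoc, nonsing_inv_mul_cancel_left _ _ hT,
        mul_nonsing_inv _ hT, Matrix.mul_one] using this
    have e2 : Aᵀ⁻¹ * A * Aᴴ = Aᴴ * A * Aᵀ⁻¹ := by
      have := congrArg (fun X => Aᵀ⁻¹ * X * Aᵀ⁻¹) h1
      simpa only [Matrix.mul_assoc, nonsing_inv_mul_cancel_left _ _ hT,
        mul_nonsing_inv _ hT, Matrix.mul_one] using this
    have e3 : B⁻¹ * (Aᵀ⁻¹ * A) = A * Aᵀ⁻¹ * B⁻¹ := by
      have := congrArg (fun X => B⁻¹ * X * B⁻¹) e1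
      simpa only [Matrix.mul_assoc, nonsing_inv_mul_cancel_left _ _ hBu,
        mul_nonsing_inv _ hBu, Matrix.mul_one] using this
    rw [hS, Matrix.mul_assoc, e3, ← Matrix.mul_assoc _ Aᴴ, e2]
    simp only [Matrix.mul_assoc]

/-- `conj(A)·A` is normal iff `A·conj(A)·Aᵀ = Aᵀ·conj(A)·A`; for nonsingular `A` these
are also equivalent to normality of the cosquare `A⁻ᵀ·A`. -/
theorem stmt_3 {n : ℕ} (A : Matrix (Fin n) (Fin n) ℂ) :
    (((A.map (starRingEnd ℂ) * A)ᴴ * (A.map (starRingEnd ℂ) * A) =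
        (A.map (starRingEnd ℂ) * A) * (A.map (starRingEnd ℂ) * A)ᴴ) ↔
      A * A.map (starRingEnd ℂ) * Aᵀ = Aᵀ * A.map (starRingEnd ℂ) * A) ∧
    (IsUnit A.det →
      (((A.map (starRingEnd ℂ) * A)ᴴ * (A.map (starRingEnd ℂ) * A) =
          (A.map (starRingEnd ℂ) * A) * (A.map (starRingEnd ℂ) * A)ᴴ) ↔
        ((A⁻¹)ᵀ * A)ᴴ * ((A⁻¹)ᵀ * A) = ((A⁻¹)ᵀ * A) * ((A⁻¹)ᵀ * A)ᴴ)) :=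
  ⟨conj_mul_self_normal_iff A, fun hA =>
    (conj_mul_self_normal_iff A).trans (cosquare_normal_iff A hA).symm⟩
end

section
/- Let A be an n×n complex matrix. Then A² is normal if and only if A²A* = A*A². If A is nonsingular, these conditions are also equivalent to the *cosquare A⁻*A being normal, where A⁻* = (A⁻¹)*. -/
open Matrix

/-- If `p²` commutes with `q` and `q²` commutes with `p`, then `q p⁻¹` commutes with `q⁻¹ p`. -/
lemma Commute.mul_inv_inv_mul_of_sq {G : Type*} [Group G] {p q : G}
    (hp : Commute (p * p) q) (hq : Commute (q * q) p) : Commute (q * p⁻¹) (q⁻¹ * p) := by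
  have hpp : Commute (p * p) (q⁻¹ * p⁻¹) :=
    hp.inv_right.mul_right (((Commute.refl p).mul_left (Commute.refl p)).inv_right)
  have hqq : Commute (q * q) (q⁻¹ * p⁻¹) :=
    (((Commute.refl q).mul_left (Commute.refl q)).inv_right).mul_right hq.inv_right
  have e₁ : q * p⁻¹ = q⁻¹ * p⁻¹ * (q * q) := by
    rw [← hqq.eq]
    group
  have e₂ : q⁻¹ * p = q⁻¹ * p⁻¹ * (p * p) := by group
  rw [e₁, e₂]
  exact ((Commute.refl _).mul_right hpp.symm).mul_left
    (hqq.mul_right (hp.mul_right hp).symm)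

section CStarAlgebra

variable {R : Type*} [CStarAlgebra R]

lemma isStarNormal_mul_self_iff {a : R} :
    IsStarNormal (a * a) ↔ Commute (a * a) (star a) := by
  constructor
  · intro h
    have hc : Commute a (star (a * a)) :=
      h.commute_star_right ((Commute.refl a).mul_right (Commute.refl a))
    have := hc.symm.star_star
    rwa [star_star] at this
  · intro h
    refine ⟨?_⟩
    rw [star_mul]
    exact (h.mul_right h).symm

lemma isStarNormal_mul_self_iff_cosquare (a : Rˣ) :
    IsStarNormal ((a : R) * a) ↔ IsStarNormal (star ((a⁻¹ : Rˣ) : R) * a) := by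
  rw [isStarNormal_mul_self_iff]
  constructor
  · intro h
    have hp : Commute (a * a) (star a) := Units.ext h
    have hq : Commute (star a * star a) a := by
      simpa only [star_mul, star_star] using hp.star_star
    have key := Commute.mul_inv_inv_mul_of_sq hp hq
    refine ⟨?_⟩
    have := congrArg Units.val key.eq
    simpa [Commute, SemiconjBy, mul_assoc] using this
  · intro h
    obtain ⟨c, hc⟩ : ∃ c : Rˣ, c = star a⁻¹ * a := ⟨_, rfl⟩
    have hcR : (c : R) = star ((a⁻¹ : Rˣ) : R) * a := by rw [hc]; rfl
    rw [← hcR] at h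
    have hac : SemiconjBy a c (star c)⁻¹ := by
      simp only [SemiconjBy, hc, star_mul, star_star, star_inv]
      group
    have hsa : star a = star c * a := by
      simp [hc]
    have hn : IsStarNormal (((star c)⁻¹ : Rˣ) : R) := by
      have h' : Commute (star c) c := Units.ext h.star_comm_self
      have key : Commute (star (star c)⁻¹) (star c)⁻¹ := by
        rw [star_inv, star_star]
        exact h'.inv_inv.symm
      exact ⟨congrArg Units.val key.eq⟩
    have hst : SemiconjBy a (star c) c⁻¹ := by
      have hR : SemiconjBy (a : R) (c : R) (((star c)⁻¹ : Rˣ) : R) :=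
        congrArg Units.val hac
      have hstar : SemiconjBy a (star c) (star (star c)⁻¹) :=
        Units.ext (hR.star_right h hn).eq
      rwa [star_inv, star_star] at hstar
    have : Commute (a * a) (star a) := by
      have h₁ : a * c⁻¹ = star c * a := by simpa using hac.inv_right.eq
      calc a * a * star a = a * (a * star c) * a := by rw [hsa]; group
        _ = a * c⁻¹ * a * a := by rw [hst.eq]; group
        _ = star a * (a * a) := by rw [h₁, hsa]; group
    exact congrArg Units.val this.eq

end CStarAlgebra

/-- `A²` is normal iff `A²·A* = A*·A²`; for nonsingular `A` these are also equivalent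
to normality of the *cosquare `A⁻*·A = (A⁻¹)ᴴ·A`. -/
theorem stmt_4 {n : ℕ} (A : Matrix (Fin n) (Fin n) ℂ) :
    (((A * A)ᴴ * (A * A) = (A * A) * (A * A)ᴴ) ↔ (A * A) * Aᴴ = Aᴴ * (A * A)) ∧
    (IsUnit A.det →
      (((A * A)ᴴ * (A * A) = (A * A) * (A * A)ᴴ) ↔
        ((A⁻¹)ᴴ * A)ᴴ * ((A⁻¹)ᴴ * A) = ((A⁻¹)ᴴ * A) * ((A⁻¹)ᴴ * A)ᴴ)) := by
  have hnormal (M : Matrix (Fin n) (Fin n) ℂ) : IsStarNormal M ↔ Mᴴ * M = M * Mᴴ :=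
    isStarNormal_iff M
  constructor
  · rw [← hnormal]
    exact @isStarNormal_mul_self_iff _ Matrix.instCStarAlgebra A
  · intro hA
    rw [← hnormal, ← hnormal]
    obtain ⟨a, rfl⟩ := (Matrix.isUnit_iff_isUnit_det A).2 hA
    rw [← Matrix.coe_units_inv]
    exact @isStarNormal_mul_self_iff_cosquare _ Matrix.instCStarAlgebra a
end

section
/- Let A be an n×n complex matrix. Then conj(A)·A is normal if and only if A is unitarily congruent to a block diagonal matrix D₁ ⊕ ⋯ ⊕ D_k in which each block D_i is either a 1×1 matrix [σ] with σ a nonnegative real number, or a 2×2 matrix τ·[[0,1],[μ,0]] with τ a positive real number and μ a complex number with μ ≠ 1. -/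
open Matrix
open scoped InnerProductSpace ComplexConjugate

section ConjugateLinear

variable {E : Type*} [NormedAddCommGroup E] [InnerProductSpace ℂ E]

theorem exists_eigenvector_of_invariant [FiniteDimensional ℂ E] (V : Submodule ℂ E) (hV : V ≠ ⊥)
    (f : E →ₗ[ℂ] E)
    (hf : ∀ x ∈ V, f x ∈ V) : ∃ c : ℂ, ∃ v ∈ V, v ≠ 0 ∧ f v = c • v := by
  have : Nontrivial V := (Submodule.nontrivial_iff_ne_bot).2 hV
  obtain ⟨c, hc⟩ := Module.End.exists_eigenvalue (f.restrict hf)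
  obtain ⟨v, hv⟩ := hc.exists_hasEigenvector
  refine ⟨c, v, v.2, fun h => hv.2 (Subtype.ext h), ?_⟩
  simpa using congrArg Subtype.val hv.apply_eq_smul

/-- `T` and `S` are conjugate-linear maps adjoint to each other, and `T ∘ T` is normal. -/
structure IsConjugateNormalPair (T S : E →ₛₗ[starRingEnd ℂ] E) : Prop where
  adjoint : ∀ x y, ⟪x, T y⟫_ℂ = ⟪y, S x⟫_ℂ
  normal : ∀ x, T (T (S (S x))) = S (S (T (T x)))

namespace IsConjugateNormalPair

variable {T S : E →ₛₗ[starRingEnd ℂ] E}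

theorem symm (h : IsConjugateNormalPair T S) : IsConjugateNormalPair S T :=
  ⟨fun x y => (h.adjoint y x).symm, fun x => (h.normal x).symm⟩

theorem adjoint_sq (h : IsConjugateNormalPair T S) (x y : E) :
    ⟪x, T (T y)⟫_ℂ = ⟪S (S x), y⟫_ℂ := by
  rw [h.adjoint, ← inner_conj_symm, h.adjoint, inner_conj_symm]

theorem sq_apply_eq (h : IsConjugateNormalPair T S) {c : ℂ} {v : E} (hv : T (T v) = c • v) :
    S (S v) = conj c • v := by
  rw [← sub_eq_zero, ← inner_self_eq_zero (𝕜 := ℂ)]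
  set y := S (S v) - conj c • v with hy
  have hTy : T (T y) = c • y := by
    simp only [hy, map_sub, LinearMap.map_smulₛₗ, h.normal, hv, smul_sub, Complex.conj_conj,
      smul_smul, mul_comm]
  conv_lhs => rw [hy]
  rw [← hy, inner_sub_left, ← h.adjoint_sq, hTy, inner_smul_left, inner_smul_right,
    Complex.conj_conj, sub_self]

theorem exists_joint_eigenvector [FiniteDimensional ℂ E]
    (h : IsConjugateNormalPair T S) (W : Submodule ℂ E)
    (hW : W ≠ ⊥) (hT : ∀ x ∈ W, T x ∈ W) (hS : ∀ x ∈ W, S x ∈ W) :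
    ∃ v ∈ W, ‖v‖ = 1 ∧ ∃ c s t : ℂ, T (T v) = c • v ∧ T (S v) = s • v ∧ S (T v) = t • v := by
  let N : E →ₗ[ℂ] E := T.comp T
  let P : E →ₗ[ℂ] E := T.comp S
  let Q : E →ₗ[ℂ] E := S.comp T
  obtain ⟨c, v, hvW, hv0, hv⟩ := exists_eigenvector_of_invariant W hW N fun x hx => hT _ (hT x hx)
  have hN : ∀ x, x ∈ LinearMap.ker (N - c • 1) ↔ T (T x) = c • x := fun x => by
    simp [N, sub_eq_zero]
  have hSS : ∀ x, T (T x) = c • x → S (S x) = conj c • x := fun x hx => h.sq_apply_eq hx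
  have hTT : ∀ x, S (S x) = conj c • x → T (T x) = c • x := fun x hx => by
    simpa using h.symm.sq_apply_eq hx
  have hNT : ∀ x, T (T x) = c • x → T (T (T x)) = conj c • T x := fun x hx => by
    rw [hx, LinearMap.map_smulₛₗ]
  have hNS : ∀ x, T (T x) = c • x → S (S (S x)) = c • S x := fun x hx => by
    rw [hSS x hx, LinearMap.map_smulₛₗ, Complex.conj_conj]
  have hNT' : ∀ x, T (T x) = c • x → S (S (T x)) = c • T x := fun x hx => by
    simpa using h.sq_apply_eq (hNT x hx)
  have hNS' : ∀ x, T (T x) = c • x → T (T (S x)) = conj c • S x := fun x hx =>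
    h.symm.sq_apply_eq (hNS x hx)
  obtain ⟨s, v, hvV, hv0, hv⟩ := exists_eigenvector_of_invariant (W ⊓ LinearMap.ker (N - c • 1))
    ((Submodule.ne_bot_iff _).2 ⟨v, ⟨hvW, (hN v).2 hv⟩, hv0⟩) P (by
      rintro x ⟨hxW, hx⟩
      rw [SetLike.mem_coe, hN] at hx
      refine ⟨hT _ (hS x hxW), (hN _).2 ?_⟩
      change T (T (T (S x))) = c • T (S x)
      rw [hNS' x hx, LinearMap.map_smulₛₗ, Complex.conj_conj])
  have hP : ∀ x, x ∈ LinearMap.ker (P - s • 1) ↔ T (S x) = s • x := fun x => by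
    simp [P, sub_eq_zero]
  obtain ⟨t, v, hvV, hv0, hv⟩ := exists_eigenvector_of_invariant
    ((W ⊓ LinearMap.ker (N - c • 1)) ⊓ LinearMap.ker (P - s • 1))
    ((Submodule.ne_bot_iff _).2 ⟨v, ⟨hvV, (hP v).2 hv⟩, hv0⟩) Q (by
      rintro x ⟨⟨hxW, hx⟩, hxP⟩
      rw [SetLike.mem_coe, hN] at hx
      rw [SetLike.mem_coe, hP] at hxP
      refine ⟨⟨hS _ (hT x hxW), (hN _).2 (hTT _ ?_)⟩, (hP _).2 ?_⟩
      · change S (S (S (T x))) = conj c • S (T x)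
        rw [hNT' x hx, LinearMap.map_smulₛₗ]
      · change T (S (S (T x))) = s • S (T x)
        have hxs : s • S (T x) = S (T (T (S x))) := by
          rw [hxP, LinearMap.map_smulₛₗ, LinearMap.map_smulₛₗ, Complex.conj_conj]
        rw [hxs, hNT' x hx, hNS' x hx, LinearMap.map_smulₛₗ, LinearMap.map_smulₛₗ, hx, hSS x hx,
          Complex.conj_conj, smul_comm])
  obtain ⟨⟨hvW, hvN⟩, hvP⟩ := hvV
  rw [SetLike.mem_coe, hN] at hvN
  rw [SetLike.mem_coe, hP] at hvP
  have hn : ((‖v‖⁻¹ : ℝ) : ℂ) ≠ 0 := by simpa using hv0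
  refine ⟨((‖v‖⁻¹ : ℝ) : ℂ) • v, W.smul_mem _ hvW, ?_, c, s, t, ?_, ?_, ?_⟩
  · rw [norm_smul]
    simp [hv0]
  · simp only [LinearMap.map_smulₛₗ, hvN, Complex.conj_ofReal]
    rw [smul_comm]
  · simp only [LinearMap.map_smulₛₗ, hvP, Complex.conj_ofReal]
    rw [smul_comm]
  · simp only [LinearMap.map_smulₛₗ, show S (T v) = t • v from hv, Complex.conj_ofReal]
    rw [smul_comm]

/-- A nonzero joint real eigenvector can be normalized. -/
theorem exists_unit_eigenvector {W : Submodule ℂ E} {u : E} (hu : u ∈ W) (hu0 : u ≠ 0) {r : ℝ}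
    (hT : T u = (r : ℂ) • u) (hS : S u = (r : ℂ) • u) :
    ∃ e ∈ W, ‖e‖ = 1 ∧ T e = (r : ℂ) • e ∧ S e = (r : ℂ) • e := by
  refine ⟨((‖u‖⁻¹ : ℝ) : ℂ) • u, W.smul_mem _ hu, ?_, ?_, ?_⟩
  · rw [norm_smul]
    simp [hu0]
  · rw [LinearMap.map_smulₛₗ, hT, Complex.conj_ofReal, smul_comm]
  · rw [LinearMap.map_smulₛₗ, hS, Complex.conj_ofReal, smul_comm]

theorem exists_unit_eigenvector_of_eq {W : Submodule ℂ E} {v : E} (hv : v ∈ W) (hv0 : v ≠ 0)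
    (hTW : ∀ x ∈ W, T x ∈ W) {r : ℝ} (hTS : S v = T v) (hTT : T (T v) = (r : ℂ) ^ 2 • v)
    (hST : S (T v) = (r : ℂ) ^ 2 • v) :
    ∃ e ∈ W, ‖e‖ = 1 ∧ T e = (r : ℂ) • e ∧ S e = (r : ℂ) • e := by
  by_cases hu : T v + (r : ℂ) • v = 0
  · have hTv : T v = -((r : ℂ) • v) := eq_neg_of_add_eq_zero_left hu
    refine exists_unit_eigenvector (W.smul_mem Complex.I hv) (by simpa using hv0) ?_ ?_
    · rw [LinearMap.map_smulₛₗ, hTv, Complex.conj_I]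
      module
    · rw [LinearMap.map_smulₛₗ, hTS, hTv, Complex.conj_I]
      module
  · refine exists_unit_eigenvector (W.add_mem (hTW v hv) (W.smul_mem (r : ℂ) hv)) hu ?_ ?_
    · rw [map_add, LinearMap.map_smulₛₗ, hTT, Complex.conj_ofReal]
      module
    · rw [map_add, LinearMap.map_smulₛₗ, hST, hTS, Complex.conj_ofReal]
      module

theorem exists_reducing_block [FiniteDimensional ℂ E]
    (h : IsConjugateNormalPair T S) (W : Submodule ℂ E)
    (hW : W ≠ ⊥) (hT : ∀ x ∈ W, T x ∈ W) (hS : ∀ x ∈ W, S x ∈ W) :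
    (∃ e ∈ W, ‖e‖ = 1 ∧ ∃ r : ℝ, 0 ≤ r ∧ T e = (r : ℂ) • e ∧ S e = (r : ℂ) • e) ∨
    (∃ e₁ ∈ W, ∃ e₂ ∈ W, ‖e₁‖ = 1 ∧ ‖e₂‖ = 1 ∧ ⟪e₁, e₂⟫_ℂ = 0 ∧ ∃ (r : ℝ) (m : ℂ), 0 < r ∧ m ≠ 1 ∧
      T e₁ = ((r : ℂ) * m) • e₂ ∧ T e₂ = (r : ℂ) • e₁ ∧
      S e₁ = (r : ℂ) • e₂ ∧ S e₂ = ((r : ℂ) * m) • e₁) := by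
  obtain ⟨v, hvW, hv1, c, s, t, hc, hs, ht⟩ := h.exists_joint_eigenvector W hW hT hS
  have hv0 : v ≠ 0 := by
    rintro rfl
    simp at hv1
  have hc' := h.sq_apply_eq hc
  have hvv : ⟪v, v⟫_ℂ = 1 := by simp [inner_self_eq_norm_sq_to_K, hv1]
  have hs' : s = (‖S v‖ : ℂ) ^ 2 := by
    have := h.adjoint v (S v)
    rwa [hs, inner_smul_right, hvv, mul_one, inner_self_eq_norm_sq_to_K] at this
  have ht' : t = (‖T v‖ : ℂ) ^ 2 := by
    have := h.adjoint (T v) v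
    rw [ht, inner_smul_right, hvv, mul_one, inner_self_eq_norm_sq_to_K] at this
    exact this.symm
  have hvTS : ⟪v, T v⟫_ℂ = ⟪v, S v⟫_ℂ := h.adjoint v v
  by_cases hSv : S v = 0
  · by_cases hTv : T v = 0
    · exact .inl ⟨v, hvW, hv1, 0, le_rfl, by simp [hTv], by simp [hSv]⟩
    · have hr : (‖T v‖ : ℂ) ≠ 0 := by simpa using hTv
      have hTT : T (T v) = 0 := by
        have : conj c • v = 0 := by rw [← hc', hSv, map_zero]
        have hc0 : c = 0 := by simpa [hv0] using this
        rw [hc, hc0, zero_smul]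
      refine .inr ⟨((‖T v‖⁻¹ : ℝ) : ℂ) • T v, W.smul_mem _ (hT v hvW), v, hvW, ?_, hv1, ?_,
        ‖T v‖, 0, by simpa using hTv, zero_ne_one, ?_, ?_, ?_, ?_⟩
      · rw [norm_smul]
        simp [hTv]
      · rw [inner_smul_left, ← inner_conj_symm, hvTS, hSv]
        simp
      · simp [LinearMap.map_smulₛₗ, hTT]
      · rw [smul_smul, Complex.ofReal_inv, mul_inv_cancel₀ hr, one_smul]
      · rw [LinearMap.map_smulₛₗ, ht, ht', Complex.conj_ofReal, smul_smul, Complex.ofReal_inv, sq,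
          inv_mul_cancel_left₀ hr]
      · simp [hSv]
  · have hr : (‖S v‖ : ℂ) ≠ 0 := by simpa using hSv
    have hTv : T v = (conj c / (‖S v‖ : ℂ) ^ 2) • S v := by
      have h1 : S (S (S v)) = c • S v := by rw [hc', LinearMap.map_smulₛₗ, Complex.conj_conj]
      have h2 : T (T (S v)) = conj c • S v := h.symm.sq_apply_eq h1
      rw [hs, hs', LinearMap.map_smulₛₗ, map_pow, Complex.conj_ofReal] at h2
      rw [div_eq_inv_mul, mul_smul, ← h2, inv_smul_smul₀ (pow_ne_zero 2 hr)]
    by_cases hm : conj c / (‖S v‖ : ℂ) ^ 2 = 1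
    · rw [hm, one_smul] at hTv
      obtain ⟨e, he, he1, h1, h2⟩ := exists_unit_eigenvector_of_eq (r := ‖S v‖) hvW hv0 hT hTv.symm
        (by rw [hTv, hs, hs']) (by
          rw [hTv, hc']
          rw [div_eq_one_iff_eq (pow_ne_zero 2 hr)] at hm
          rw [hm])
      exact .inl ⟨e, he, he1, _, norm_nonneg _, h1, h2⟩
    · refine .inr ⟨v, hvW, ((‖S v‖⁻¹ : ℝ) : ℂ) • S v, W.smul_mem _ (hS v hvW), hv1, ?_, ?_,
        ‖S v‖, conj c / (‖S v‖ : ℂ) ^ 2, by simpa using hSv, hm, ?_, ?_, ?_, ?_⟩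
      · rw [norm_smul]
        simp [hSv]
      · rw [hTv, inner_smul_right] at hvTS
        have h0 : ⟪v, S v⟫_ℂ = 0 := by
          by_contra h0
          exact hm (mul_right_cancel₀ h0 (by rw [hvTS, one_mul]))
        rw [inner_smul_right, h0, mul_zero]
      · rw [hTv, smul_smul]
        congr 1
        push_cast
        field_simp
      · rw [LinearMap.map_smulₛₗ, hs, hs', Complex.conj_ofReal, smul_smul]
        congr 1
        push_cast
        field_simp
      · rw [smul_smul, Complex.ofReal_inv, mul_inv_cancel₀ hr, one_smul]
      · rw [LinearMap.map_smulₛₗ, hc', Complex.conj_ofReal, smul_smul]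
        congr 1
        push_cast
        field_simp

/-- `W` has an orthonormal basis in which `T` is block diagonal. -/
def HasBlockBasis (T : E →ₛₗ[starRingEnd ℂ] E) (W : Submodule ℂ E) : Prop :=
  ∃ (α β : Type) (_ : Fintype α) (_ : Fintype β) (b : α ⊕ Fin 2 × β → E)
    (σ : α → ℝ) (τ : β → ℝ) (μ : β → ℂ),
    Orthonormal ℂ b ∧ (∀ i, b i ∈ W) ∧
    Fintype.card α + 2 * Fintype.card β = Module.finrank ℂ W ∧
    (∀ i, 0 ≤ σ i) ∧ (∀ j, 0 < τ j) ∧ (∀ j, μ j ≠ 1) ∧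
    (∀ i, T (b (.inl i)) = (σ i : ℂ) • b (.inl i)) ∧
    (∀ j, T (b (.inr (0, j))) = ((τ j : ℂ) * μ j) • b (.inr (1, j))) ∧
    (∀ j, T (b (.inr (1, j))) = (τ j : ℂ) • b (.inr (0, j)))

theorem HasBlockBasis.sup [FiniteDimensional ℂ E] {W₁ W : Submodule ℂ E}
    (hW : W₁ ≤ W) (h₁ : HasBlockBasis T W₁)
    (h₂ : HasBlockBasis T (W₁ᗮ ⊓ W)) : HasBlockBasis T W := by
  obtain ⟨α₁, β₁, _, _, b₁, σ₁, τ₁, μ₁, ho₁, hm₁, hd₁, hσ₁, hτ₁, hμ₁, hT₁, hT₁', hT₁''⟩ := h₁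
  obtain ⟨α₂, β₂, _, _, b₂, σ₂, τ₂, μ₂, ho₂, hm₂, hd₂, hσ₂, hτ₂, hμ₂, hT₂, hT₂', hT₂''⟩ := h₂
  refine ⟨α₁ ⊕ α₂, β₁ ⊕ β₂, inferInstance, inferInstance,
    Sum.elim (Sum.elim (b₁ ∘ .inl) (b₂ ∘ .inl))
      (fun x => Sum.elim (fun j => b₁ (.inr (x.1, j))) (fun j => b₂ (.inr (x.1, j))) x.2),
    Sum.elim σ₁ σ₂, Sum.elim τ₁ τ₂, Sum.elim μ₁ μ₂, ?_, ?_, ?_, ?_, ?_, ?_, ?_, ?_, ?_⟩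
  · have h12 : ∀ i j, ⟪b₁ i, b₂ j⟫_ℂ = 0 := fun i j =>
      Submodule.inner_right_of_mem_orthogonal (hm₁ i) (hm₂ j).1
    have h21 : ∀ i j, ⟪b₂ i, b₁ j⟫_ℂ = 0 := fun i j => inner_eq_zero_symm.1 (h12 j i)
    classical
    rw [orthonormal_iff_ite] at ho₁ ho₂ ⊢
    rintro ((i | i) | ⟨k, i | i⟩) ((j | j) | ⟨l, j | j⟩) <;> simp [h12, h21, ho₁, ho₂]
  · rintro ((i | i) | ⟨k, i | i⟩)
    exacts [hW (hm₁ _), (hm₂ _).2, hW (hm₁ _), (hm₂ _).2]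
  · rw [← Submodule.finrank_add_inf_finrank_orthogonal hW, ← hd₁, ← hd₂]
    simp only [Fintype.card_sum]
    ring
  all_goals rintro (i | i) <;> simp [*]

theorem hasBlockBasis_of_invariant [FiniteDimensional ℂ E]
    (h : IsConjugateNormalPair T S) (W : Submodule ℂ E)
    (hT : ∀ x ∈ W, T x ∈ W) (hS : ∀ x ∈ W, S x ∈ W) : HasBlockBasis T W := by
  induction hn : Module.finrank ℂ W using Nat.strong_induction_on generalizing W with
  | _ n ih =>
  by_cases hW : W = ⊥
  · subst hW
    exact ⟨Empty, Empty, inferInstance, inferInstance, fun i => 0, fun i => 0, fun i => 0,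
      fun i => 0, ⟨fun i => isEmptyElim i, fun i => isEmptyElim i⟩,
      by simp, by simp, by simp, by simp, by simp, by simp, by simp, by simp⟩
  have key : ∀ W₁ : Submodule ℂ E, W₁ ≤ W → W₁ ≠ ⊥ → (∀ x ∈ W₁, T x ∈ W₁) → (∀ x ∈ W₁, S x ∈ W₁) →
      HasBlockBasis T W₁ → HasBlockBasis T W := by
    intro W₁ hle hne hT₁ hS₁ hb
    refine hb.sup hle (ih _ ?_ _ ?_ ?_ rfl)
    · rw [← hn, ← Submodule.finrank_add_inf_finrank_orthogonal hle]
      have := Submodule.one_le_finrank_iff.2 hne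
      omega
    · rintro x ⟨hx, hxW⟩
      refine ⟨fun u hu => ?_, hT x hxW⟩
      rw [h.adjoint]
      exact inner_eq_zero_symm.1 (hx _ (hS₁ u hu))
    · rintro x ⟨hx, hxW⟩
      refine ⟨fun u hu => ?_, hS x hxW⟩
      rw [h.symm.adjoint]
      exact inner_eq_zero_symm.1 (hx _ (hT₁ u hu))
  rcases h.exists_reducing_block W hW hT hS with
    ⟨e, he, he1, r, hr, hTe, hSe⟩ |
    ⟨e₁, he₁, e₂, he₂, hn₁, hn₂, h12, r, m, hr, hm, hT₁, hT₂, hS₁, hS₂⟩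
  · have hmem := Submodule.mem_span_singleton_self (R := ℂ) e
    have he0 : e ≠ 0 := by
      rintro rfl
      simp at he1
    have hinv : ∀ F : E →ₛₗ[starRingEnd ℂ] E, F e = (r : ℂ) • e →
        ∀ x ∈ ℂ ∙ e, F x ∈ ℂ ∙ e := by
      intro F hF x hx
      obtain ⟨a, rfl⟩ := Submodule.mem_span_singleton.1 hx
      rw [LinearMap.map_smulₛₗ, hF]
      exact Submodule.smul_mem _ _ (Submodule.smul_mem _ _ hmem)
    refine key (ℂ ∙ e) (by simpa using he) (by simpa using he0) (hinv T hTe) (hinv S hSe) ?_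
    refine ⟨Unit, Empty, inferInstance, inferInstance, fun _ => e, fun _ => r, fun i => 0,
      fun i => 0, ⟨fun i => he1, ?_⟩, fun _ => hmem, ?_, fun _ => hr, ?_, ?_, fun _ => hTe, ?_, ?_⟩
    · rintro (i | ⟨-, i⟩) (j | ⟨-, j⟩)
      · simp
      · exact j.elim
      · exact i.elim
      · exact i.elim
    · simp [finrank_span_singleton he0]
    all_goals simp
  · have hm₁ : e₁ ∈ Submodule.span ℂ {e₁, e₂} := Submodule.subset_span (by simp)
    have hm₂ : e₂ ∈ Submodule.span ℂ {e₁, e₂} := Submodule.subset_span (by simp)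
    have he0 : e₁ ≠ 0 := by
      rintro rfl
      simp at hn₁
    have ho : Orthonormal ℂ ![e₁, e₂] := by
      simp [hn₁, hn₂, h12]
    have hinv : ∀ (F : E →ₛₗ[starRingEnd ℂ] E) (a b : ℂ), F e₁ = a • e₂ → F e₂ = b • e₁ →
        ∀ x ∈ Submodule.span ℂ {e₁, e₂}, F x ∈ Submodule.span ℂ {e₁, e₂} := by
      intro F a b h1 h2 x hx
      obtain ⟨p, q, rfl⟩ := Submodule.mem_span_pair.1 hx
      rw [map_add, LinearMap.map_smulₛₗ, LinearMap.map_smulₛₗ, h1, h2]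
      exact add_mem (Submodule.smul_mem _ _ (Submodule.smul_mem _ _ hm₂))
        (Submodule.smul_mem _ _ (Submodule.smul_mem _ _ hm₁))
    refine key (Submodule.span ℂ {e₁, e₂})
      (by simp [Submodule.span_le, Set.insert_subset_iff, he₁, he₂])
      ((Submodule.ne_bot_iff _).2 ⟨e₁, hm₁, he0⟩) (hinv T _ _ hT₁ hT₂) (hinv S _ _ hS₁ hS₂) ?_
    refine ⟨Empty, Unit, inferInstance, inferInstance, Sum.elim (fun _ => 0) fun x => ![e₁, e₂] x.1,
      fun _ => 0, fun _ => r, fun _ => m, ?_, ?_, ?_, ?_, fun _ => hr, fun _ => hm, ?_,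
      fun _ => hT₁, fun _ => hT₂⟩
    · rw [orthonormal_iff_ite] at ho ⊢
      rintro (i | ⟨i, -⟩) (j | ⟨j, -⟩)
      · exact i.elim
      · exact i.elim
      · exact j.elim
      · simpa using ho i j
    · rintro (i | ⟨i, -⟩)
      · exact i.elim
      · fin_cases i
        exacts [hm₁, hm₂]
    · have := finrank_span_eq_card ho.linearIndependent
      rw [Matrix.range_cons_cons_empty] at this
      simpa using this.symm
    all_goals simp

end IsConjugateNormalPair

end ConjugateLinear

section Matrix

variable {ι : Type*} [Fintype ι]

theorem star_mulVec_eq (A : Matrix ι ι ℂ) (v : ι → ℂ) :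
    star (A *ᵥ v) = A.map (starRingEnd ℂ) *ᵥ star v := by
  ext i
  simp [mulVec, dotProduct]

/-- The conjugate-linear map `x ↦ A * conj x`. -/
noncomputable def conjMulVec (A : Matrix ι ι ℂ) :
    EuclideanSpace ℂ ι →ₛₗ[starRingEnd ℂ] EuclideanSpace ℂ ι where
  toFun x := WithLp.toLp 2 (A *ᵥ star x.ofLp)
  map_add' x y := by simp [mulVec_add]
  map_smul' c x := by simp [mulVec_smul]

theorem conjMulVec_conjMulVec (A : Matrix ι ι ℂ) (x : EuclideanSpace ℂ ι) :
    conjMulVec A (conjMulVec A x) =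
      WithLp.toLp 2 ((A * A.map (starRingEnd ℂ)) *ᵥ x.ofLp) := by
  simp [conjMulVec, star_mulVec_eq, mulVec_mulVec]

theorem isConjugateNormalPair_conjMulVec (A : Matrix ι ι ℂ)
    (hA : (A.map (starRingEnd ℂ) * A)ᴴ * (A.map (starRingEnd ℂ) * A) =
      (A.map (starRingEnd ℂ) * A) * (A.map (starRingEnd ℂ) * A)ᴴ) :
    IsConjugateNormalPair (conjMulVec A) (conjMulVec Aᵀ) where
  adjoint x y := by
    simp only [EuclideanSpace.inner_eq_star_dotProduct, conjMulVec, LinearMap.coe_mk,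
      AddHom.coe_mk]
    rw [dotProduct_comm, dotProduct_mulVec, ← mulVec_transpose]
  normal x := by
    have h : (A * A.map (starRingEnd ℂ)) * (Aᵀ * Aᵀ.map (starRingEnd ℂ)) =
        (Aᵀ * Aᵀ.map (starRingEnd ℂ)) * (A * A.map (starRingEnd ℂ)) := by
      have hconj := congrArg (fun M : Matrix ι ι ℂ => M.map (starRingEnd ℂ)) hA
      have h1 : (A.map (starRingEnd ℂ))ᴴ = Aᵀ := by
        ext
        simp
      have h2 : Aᴴ.map (starRingEnd ℂ) = Aᵀ := by
        ext
        simp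
      have h3 : (A.map (starRingEnd ℂ)).map (starRingEnd ℂ) = A := by
        ext
        simp
      simp only [conjTranspose_mul, Matrix.map_mul, h1, h2, h3] at hconj
      exact hconj.symm
    simp only [conjMulVec_conjMulVec, mulVec_mulVec, h]

variable [DecidableEq ι]

theorem conj_mul_self_normal_of_congruent (A U D : Matrix ι ι ℂ) (d : ι → ℂ) (hU : Uᴴ * U = 1)
    (hD : D.map (starRingEnd ℂ) * D = diagonal d) (hA : A = U * D * Uᵀ) :
    (A.map (starRingEnd ℂ) * A)ᴴ * (A.map (starRingEnd ℂ) * A) =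
      (A.map (starRingEnd ℂ) * A) * (A.map (starRingEnd ℂ) * A)ᴴ := by
  set V := U.map (starRingEnd ℂ) with hV
  have hVU : Uᵀ.map (starRingEnd ℂ) = Uᴴ := by
    ext
    simp
  have hVH : Vᴴ = Uᵀ := by
    ext
    simp [V]
  have hUV : Uᵀ * V = 1 := by
    have := congrArg transpose hU
    rw [transpose_mul, transpose_one] at this
    rw [← this]
    congr 1
  have hUH : Uᵀᴴ = V := by
    rw [← hVH, conjTranspose_conjTranspose]
  have hX : A.map (starRingEnd ℂ) * A = V * diagonal d * Uᵀ := by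
    rw [hA, Matrix.map_mul, Matrix.map_mul, hVU, ← hV, ← hD]
    simp only [Matrix.mul_assoc]
    rw [← Matrix.mul_assoc Uᴴ, hU, Matrix.one_mul]
  have hmul : ∀ x y : ι → ℂ, V * diagonal x * Uᵀ * (V * diagonal y * Uᵀ) =
      V * diagonal (fun i => x i * y i) * Uᵀ := by
    intro x y
    rw [← diagonal_mul_diagonal]
    simp only [Matrix.mul_assoc]
    rw [← Matrix.mul_assoc Uᵀ, hUV, Matrix.one_mul]
  have hXH : (V * diagonal d * Uᵀ)ᴴ = V * diagonal (star d) * Uᵀ := by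
    rw [conjTranspose_mul, conjTranspose_mul, hVH, hUH, diagonal_conjTranspose, Matrix.mul_assoc]
  rw [hX, hXH, hmul, hmul]
  simp only [mul_comm]

theorem eq_mul_mul_transpose {κ : Type*} [Fintype κ] [DecidableEq κ] (A : Matrix ι ι ℂ)
    (D : Matrix κ κ ℂ) (e : κ ≃ ι) (b : κ → EuclideanSpace ℂ ι) (hb : Orthonormal ℂ b)
    (hA : ∀ k, conjMulVec A (b k) = ∑ l, D l k • b l) :
    ∃ U : Matrix ι ι ℂ, Uᴴ * U = 1 ∧ A = U * D.submatrix e.symm e.symm * Uᵀ := by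
  let U : Matrix ι ι ℂ := of fun i j => b (e.symm j) i
  have hU : Uᴴ * U = 1 := by
    ext i j
    have := (orthonormal_iff_ite.1 hb) (e.symm i) (e.symm j)
    rw [EuclideanSpace.inner_eq_star_dotProduct] at this
    simpa [mul_apply, U, dotProduct, one_apply, mul_comm] using this
  have hU' : U.map (starRingEnd ℂ) * Uᵀ = 1 := by
    have := congrArg transpose (mul_eq_one_comm.1 hU)
    rw [transpose_mul, transpose_one] at this
    rw [← this]
    congr 1
  have hAU : A * U.map (starRingEnd ℂ) = U * D.submatrix e.symm e.symm := by
    ext i j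
    have := congrArg (fun x : EuclideanSpace ℂ ι => x i) (hA (e.symm j))
    simp only [conjMulVec, LinearMap.coe_mk, AddHom.coe_mk, mulVec, dotProduct, Pi.star_apply,
      WithLp.ofLp_sum, WithLp.ofLp_smul, Finset.sum_apply, Pi.smul_apply, smul_eq_mul] at this
    simp only [mul_apply, U, map_apply, of_apply, submatrix_apply, starRingEnd_apply, this]
    rw [← e.symm.sum_comp]
    simp only [mul_comm]
  refine ⟨U, hU, ?_⟩
  rw [← hAU, Matrix.mul_assoc, hU', Matrix.mul_one]

end Matrix

/-- `conj(A)·A` is normal iff `A` is unitarily congruent to a block diagonal matrix whose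
blocks are `[σ]` with `σ ≥ 0` real, or `τ·[[0,1],[μ,0]]` with `τ > 0` real and `μ ≠ 1`. -/
theorem stmt_5 {n : ℕ} (A : Matrix (Fin n) (Fin n) ℂ) :
    ((A.map (starRingEnd ℂ) * A)ᴴ * (A.map (starRingEnd ℂ) * A) =
      (A.map (starRingEnd ℂ) * A) * (A.map (starRingEnd ℂ) * A)ᴴ) ↔
    ∃ (U : Matrix (Fin n) (Fin n) ℂ) (p q : ℕ)
      (e : (Fin p ⊕ Fin 2 × Fin q) ≃ Fin n)
      (σ : Fin p → ℝ) (τ : Fin q → ℝ) (μ : Fin q → ℂ),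
      Uᴴ * U = 1 ∧ (∀ i, 0 ≤ σ i) ∧ (∀ j, 0 < τ j) ∧ (∀ j, μ j ≠ 1) ∧
      A = U * (Matrix.fromBlocks (Matrix.diagonal fun i => (σ i : ℂ)) 0 0
                (Matrix.blockDiagonal fun j =>
                  (τ j : ℂ) • !![0, 1; μ j, 0])).submatrix e.symm e.symm * Uᵀ := by
  constructor
  · intro hA
    obtain ⟨α, β, _, _, b, σ, τ, μ, hb, -, hcard, hσ, hτ, hμ, hT₁, hT₂, hT₃⟩ :=
      (isConjugateNormalPair_conjMulVec A hA).hasBlockBasis_of_invariant ⊤ (by simp) (by simp)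
    let a := (Fintype.equivFin α).symm
    let c := (Fintype.equivFin β).symm
    let f := Equiv.sumCongr a (Equiv.prodCongr (Equiv.refl (Fin 2)) c)
    let e : (Fin (Fintype.card α) ⊕ Fin 2 × Fin (Fintype.card β)) ≃ Fin n :=
      Fintype.equivOfCardEq (by simpa using hcard)
    obtain ⟨U, hU, hAU⟩ := eq_mul_mul_transpose A
      (fromBlocks (diagonal fun i => (σ (a i) : ℂ)) 0 0
        (blockDiagonal fun j => (τ (c j) : ℂ) • !![0, 1; μ (c j), 0]))
      e (b ∘ f) (hb.comp _ f.injective) (by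
        rintro (i | ⟨k, j⟩)
        · simp [f, hT₁, diagonal_apply]
        · fin_cases k <;>
            simp [f, hT₂, hT₃, Fintype.sum_prod_type, blockDiagonal_apply])
    exact ⟨U, _, _, e, σ ∘ a, τ ∘ c, μ ∘ c, hU, fun i => hσ _, fun j => hτ _, fun j => hμ _, hAU⟩
  · rintro ⟨U, p, q, e, σ, τ, μ, hU, -, -, -, hA⟩
    refine conj_mul_self_normal_of_congruent A U _
      (Sum.elim (fun i => (σ i : ℂ) ^ 2)
        (fun x => (τ x.2 : ℂ) ^ 2 * ![μ x.2, conj (μ x.2)] x.1) ∘ e.symm) hU ?_ hA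
    rw [← submatrix_diagonal_equiv, ← submatrix_map, submatrix_mul_equiv]
    congr 1
    rw [fromBlocks_map, fromBlocks_multiply]
    ext (i | ⟨k, i⟩) (j | ⟨l, j⟩)
    · by_cases h : i = j <;> simp [h, sq]
    · simp
    · simp
    · fin_cases k <;> fin_cases l <;> by_cases h : i = j <;>
        simp [mul_apply, Fintype.sum_prod_type, blockDiagonal_apply, h, sq] <;> ring
end

section
/- Let A be an n×n complex matrix. Then A² is normal if and only if A is unitarily *congruent to a block diagonal matrix D₁ ⊕ ⋯ ⊕ D_k in which each block D_i is either a 1×1 matrix [λ] with λ a complex number, or a 2×2 upper triangular matrix [[ν, r],[0, −ν]] with r a positive real number and ν a complex number lying in D₊ = {z ∈ ℂ : Re z > 0} ∪ {it : t ∈ ℝ, t ≥ 0}. -/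
open Matrix

section ReducingSubspaces

open ComplexConjugate

variable {V : Type*} [NormedAddCommGroup V] [InnerProductSpace ℂ V]

lemma eq_smul_of_adjoint_of_map_sub {P Q : V →ₗ[ℂ] V}
    (hadj : ∀ x y, inner ℂ (Q x) y = inner ℂ x (P y)) {μ : ℂ} {x : V}
    (h : P (Q x - conj μ • x) = μ • (Q x - conj μ • x)) : Q x = conj μ • x := by
  rw [← sub_eq_zero, ← inner_self_eq_zero (𝕜 := ℂ)]
  set w := Q x - conj μ • x with hw
  nth_rewrite 1 [hw]
  rw [inner_sub_left, hadj, h, inner_smul_left, inner_smul_right]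
  simp

lemma adjoint_eigenvector_of_normal {P Q : V →ₗ[ℂ] V}
    (hadj : ∀ x y, inner ℂ (Q x) y = inner ℂ x (P y)) (hcomm : ∀ x, P (Q x) = Q (P x))
    {μ : ℂ} {x : V} (h : P x = μ • x) : Q x = conj μ • x := by
  apply eq_smul_of_adjoint_of_map_sub hadj
  simp only [map_sub, map_smul, hcomm, h, smul_sub]
  rw [smul_comm]

lemma exists_eigenvector_mem [FiniteDimensional ℂ V] (f : V →ₗ[ℂ] V) {W : Submodule ℂ V}
    (hf : ∀ x ∈ W, f x ∈ W) (hW : W ≠ ⊥) : ∃ μ : ℂ, ∃ x ∈ W, x ≠ 0 ∧ f x = μ • x := by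
  have : Nontrivial W := Submodule.nontrivial_iff_ne_bot.mpr hW
  obtain ⟨μ, hμ⟩ := Module.End.exists_eigenvalue (f.restrict hf)
  obtain ⟨x, hx⟩ := hμ.exists_hasEigenvector
  refine ⟨μ, x, x.2, fun h => hx.2 (Subtype.ext h), ?_⟩
  simpa using congrArg Subtype.val hx.apply_eq_smul

lemma exists_sqrt_in_half_plane (μ : ℂ) :
    ∃ ν : ℂ, ν * ν = μ ∧ (0 < ν.re ∨ (ν.re = 0 ∧ 0 ≤ ν.im)) := by
  obtain ⟨z, hz⟩ := IsAlgClosed.exists_eq_mul_self μ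
  by_cases h : 0 < z.re ∨ (z.re = 0 ∧ 0 ≤ z.im)
  · exact ⟨z, hz.symm, h⟩
  · refine ⟨-z, by rw [hz]; ring, ?_⟩
    simp only [Complex.neg_re, Complex.neg_im]
    push Not at h
    rcases lt_or_eq_of_le h.1 with h1 | h1
    · left; linarith
    · right; exact ⟨by linarith, by linarith [h.2 h1]⟩

/-- A unit vector spanning a one-dimensional subspace that is invariant under `T` and its
adjoint `S`. -/
def IsReducingVector (T S : V →ₗ[ℂ] V) (l : ℂ) (x : V) : Prop :=
  ‖x‖ = 1 ∧ T x = l • x ∧ S x = conj l • x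

/-- An orthonormal pair spanning a subspace, invariant under `T` and its adjoint `S`, on which
`T` has the matrix `[[ν, r], [0, -ν]]`. -/
def IsReducingPair (T S : V →ₗ[ℂ] V) (ν : ℂ) (r : ℝ) (x y : V) : Prop :=
  ‖x‖ = 1 ∧ ‖y‖ = 1 ∧ inner ℂ x y = 0 ∧ T x = ν • x ∧ T y = (r : ℂ) • x - ν • y ∧
    S x = (r : ℂ) • y + conj ν • x ∧ S y = -(conj ν • y)

lemma isReducingPair_of_eigenvector {T S : V →ₗ[ℂ] V}
    (hadj : ∀ x y, inner ℂ (S x) y = inner ℂ x (T y)) {ν h : ℂ} {x : V} (hx : ‖x‖ = 1)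
    (hTx : T x = ν • x) (hSS : S (S x) = conj (ν * ν) • x)
    (hH : T (S x) + S (T x) = h • x) (hne : S x ≠ conj ν • x) :
    IsReducingPair T S ν ‖S x - conj ν • x‖ x
      (((‖S x - conj ν • x‖ : ℂ)⁻¹) • (S x - conj ν • x)) := by
  set e := S x - conj ν • x with he
  have he0 : e ≠ 0 := sub_ne_zero.mpr hne
  have hr : (‖e‖ : ℂ) ≠ 0 := by exact_mod_cast norm_ne_zero_iff.mpr he0
  have hSx : S x = e + conj ν • x := by rw [he]; abel
  have hxx : inner ℂ x x = (1 : ℂ) := by rw [inner_self_eq_norm_sq_to_K, hx]; simp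
  have hxe : inner ℂ x e = (0 : ℂ) := by
    have h1 : inner ℂ (S x) x = ν := by rw [hadj, hTx, inner_smul_right, hxx, mul_one]
    rw [he, inner_sub_right, inner_smul_right, hxx, ← inner_conj_symm, h1]
    simp
  have hSe : S e = -(conj ν • e) := by
    rw [he, map_sub, map_smul, hSS, map_mul]
    module
  have hTe : T e = (h - 2 * (ν * conj ν)) • x - ν • e := by
    have h2 : T (S x) = h • x - ν • S x := by
      rw [← hH, hTx, map_smul]; abel
    rw [he, map_sub, map_smul, h2, hTx]
    module
  have hk : h - 2 * (ν * conj ν) = (‖e‖ : ℂ) * ‖e‖ := by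
    have h3 : inner ℂ x (T e) = h - 2 * (ν * conj ν) := by
      rw [hTe, inner_sub_right, inner_smul_right, inner_smul_right, hxx, hxe]; ring
    rw [← h3, ← hadj, hSx, inner_add_left, inner_smul_left, hxe, inner_self_eq_norm_sq_to_K]
    simp [sq]
  refine ⟨hx, ?_, ?_, hTx, ?_, ?_, ?_⟩
  · rw [norm_smul]; simp [he0]
  · rw [inner_smul_right, hxe, mul_zero]
  · rw [map_smul, hTe, hk, smul_sub, smul_smul, ← mul_assoc, inv_mul_cancel₀ hr, one_mul,
      smul_comm ν]
  · rw [smul_smul, mul_inv_cancel₀ hr, one_smul, hSx]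
  · rw [map_smul, hSe, smul_neg, smul_comm]

lemma exists_reducing [FiniteDimensional ℂ V] {T S : V →ₗ[ℂ] V}
    (hadj : ∀ x y, inner ℂ (S x) y = inner ℂ x (T y))
    (hN : ∀ x, T (T (S (S x))) = S (S (T (T x))))
    {W : Submodule ℂ V} (hT : ∀ x ∈ W, T x ∈ W) (hS : ∀ x ∈ W, S x ∈ W) (hW : W ≠ ⊥) :
    (∃ x ∈ W, ∃ l, IsReducingVector T S l x) ∨
    (∃ x ∈ W, ∃ y ∈ W, ∃ (ν : ℂ) (r : ℝ), 0 < r ∧ (0 < ν.re ∨ (ν.re = 0 ∧ 0 ≤ ν.im)) ∧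
      IsReducingPair T S ν r x y) := by
  have hadj' : ∀ x y, inner ℂ (T x) y = inner ℂ x (S y) := fun x y => by
    rw [← inner_conj_symm, ← hadj, inner_conj_symm]
  obtain ⟨μ, x₀, hx₀, hx₀0, hμ⟩ := exists_eigenvector_mem (T ∘ₗ T)
    (fun x hx => hT _ (hT _ hx)) hW
  have toS : ∀ x, T (T x) = μ • x → S (S x) = conj μ • x := fun x hx =>
    adjoint_eigenvector_of_normal (P := T ∘ₗ T) (Q := S ∘ₗ S) (by simp [hadj]) hN hx
  have toT : ∀ x, S (S x) = conj μ • x → T (T x) = μ • x := fun x hx => by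
    simpa using adjoint_eigenvector_of_normal (P := S ∘ₗ S) (Q := T ∘ₗ T) (by simp [hadj'])
      (fun x => (hN x).symm) hx
  let E : Submodule ℂ V := W ⊓ LinearMap.eqLocus (T ∘ₗ T) (μ • LinearMap.id)
  have memE : ∀ x, x ∈ E ↔ x ∈ W ∧ T (T x) = μ • x := fun x => Iff.rfl
  have hTE : ∀ x ∈ E, T x ∈ E := fun x hx =>
    ⟨hT _ hx.1, by rw [memE] at hx; change T (T (T x)) = μ • T x; rw [hx.2, map_smul]⟩
  have hSE : ∀ x ∈ E, S x ∈ E := fun x hx => by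
    rw [memE] at hx ⊢
    exact ⟨hS _ hx.1, toT _ (by rw [toS _ hx.2, map_smul])⟩
  have hE : E ≠ ⊥ := (Submodule.ne_bot_iff _).mpr ⟨x₀, ⟨hx₀, hμ⟩, hx₀0⟩
  obtain ⟨h, x₁, hx₁, hx₁0, hh⟩ := exists_eigenvector_mem (T ∘ₗ S + S ∘ₗ T)
    (fun x hx => E.add_mem (hTE _ (hSE _ hx)) (hSE _ (hTE _ hx))) hE
  let F : Submodule ℂ V := E ⊓ LinearMap.eqLocus (T ∘ₗ S + S ∘ₗ T) (h • LinearMap.id)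
  have memF : ∀ x, x ∈ F ↔ x ∈ E ∧ T (S x) + S (T x) = h • x := fun x => Iff.rfl
  have hTF : ∀ x ∈ F, T x ∈ F := fun x hx => by
    rw [memF] at hx ⊢
    refine ⟨hTE _ hx.1, ?_⟩
    have h1 : T (T x) = μ • x := hx.1.2
    have h2 : T (T (S x)) = μ • S x := (hSE _ hx.1).2
    rw [← map_smul, ← hx.2, map_add, h1, h2, map_smul, add_comm]
  have hSF : ∀ x ∈ F, S x ∈ F := fun x hx => by
    rw [memF] at hx ⊢
    refine ⟨hSE _ hx.1, ?_⟩
    have h1 := toS _ hx.1.2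
    have h2 := toS _ (hTE _ hx.1).2
    rw [← map_smul, ← hx.2, map_add, h1, h2, map_smul, add_comm]
  obtain ⟨ν, hν, hD⟩ := exists_sqrt_in_half_plane μ
  by_cases hex : ∃ x ∈ F, x ≠ 0 ∧ T x = ν • x
  · obtain ⟨x', hx'F, hx'0, hx'T⟩ := hex
    obtain ⟨x, hxF, hx1, hxT⟩ : ∃ x ∈ F, ‖x‖ = 1 ∧ T x = ν • x := by
      refine ⟨(‖x'‖ : ℂ)⁻¹ • x', F.smul_mem _ hx'F, ?_, ?_⟩
      · rw [norm_smul]; simp [hx'0]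
      · rw [map_smul, hx'T, smul_comm]
    by_cases hne : S x = conj ν • x
    · exact Or.inl ⟨x, hxF.1.1, ν, hx1, hxT, hne⟩
    · right
      refine ⟨x, hxF.1.1, _, ?_, ν, _, ?_, hD, isReducingPair_of_eigenvector hadj hx1 hxT
        (by rw [hν]; exact toS _ hxF.1.2) hxF.2 hne⟩
      · exact W.smul_mem _ (W.sub_mem (hS _ hxF.1.1) (W.smul_mem _ hxF.1.1))
      · exact norm_pos_iff.mpr (sub_ne_zero.mpr hne)
  · push Not at hex
    have hneg : ∀ x ∈ F, T x = (-ν) • x := fun x hx => by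
      by_contra hc
      refine hex (T x + ν • x) (F.add_mem (hTF _ hx) (F.smul_mem _ hx)) (fun h0 => hc ?_) ?_
      · rw [neg_smul]; exact eq_neg_of_add_eq_zero_left h0
      · have : T (T x) = μ • x := hx.1.2
        rw [map_add, map_smul, this, ← hν]
        module
    have hx₁F : x₁ ∈ F := ⟨hx₁, hh⟩
    have hxF := F.smul_mem ((‖x₁‖ : ℂ)⁻¹) hx₁F
    refine Or.inl ⟨_, hxF.1.1, -ν, ?_, hneg _ hxF, ?_⟩
    · rw [norm_smul]; simp [hx₁0]
    · exact eq_smul_of_adjoint_of_map_sub hadj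
        (hneg _ (F.sub_mem (hSF _ hxF) (F.smul_mem _ hxF)))

/-- The subspace of `W` orthogonal to `v` stays invariant under `T` when `S` maps the span of `v`
to itself. -/
lemma map_mem_inf_orthogonal {T S : V →ₗ[ℂ] V}
    (hadj : ∀ x y, inner ℂ (S x) y = inner ℂ x (T y)) {W K : Submodule ℂ V}
    (hT : ∀ x ∈ W, T x ∈ W) (hK : ∀ x ∈ K, S x ∈ K) : ∀ x ∈ W ⊓ Kᗮ, T x ∈ W ⊓ Kᗮ :=
  fun x hx => ⟨hT _ hx.1, fun u hu => by rw [← hadj]; exact hx.2 _ (hK u hu)⟩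

/-- `W` has an orthonormal basis in which `T` is block diagonal with blocks `[λ]` and
`[[ν, r], [0, -ν]]`. -/
def HasBlockBasis (T : V →ₗ[ℂ] V) (W : Submodule ℂ V) : Prop :=
  ∃ (p q : ℕ) (b : Fin p ⊕ Fin 2 × Fin q → V) (lam : Fin p → ℂ) (r : Fin q → ℝ) (ν : Fin q → ℂ),
    Orthonormal ℂ b ∧ (∀ i, b i ∈ W) ∧ Module.finrank ℂ W = p + 2 * q ∧ (∀ j, 0 < r j) ∧
    (∀ j, 0 < (ν j).re ∨ ((ν j).re = 0 ∧ 0 ≤ (ν j).im)) ∧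
    (∀ i, T (b (.inl i)) = lam i • b (.inl i)) ∧
    (∀ j, T (b (.inr (0, j))) = ν j • b (.inr (0, j))) ∧
    (∀ j, T (b (.inr (1, j))) = (r j : ℂ) • b (.inr (0, j)) - ν j • b (.inr (1, j)))

lemma finrank_eq_card_add_inf_orthogonal [FiniteDimensional ℂ V] {m : ℕ} {v : Fin m → V}
    (hv : Orthonormal ℂ v) {W : Submodule ℂ V} (hW : ∀ i, v i ∈ W) :
    Module.finrank ℂ W =
      m + Module.finrank ℂ (W ⊓ (Submodule.span ℂ (Set.range v))ᗮ : Submodule ℂ V) := by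
  have h := Submodule.finrank_add_inf_finrank_orthogonal
    (show Submodule.span ℂ (Set.range v) ≤ W from
      Submodule.span_le.mpr (Set.range_subset_iff.mpr hW))
  rw [finrank_span_eq_card hv.linearIndependent, Fintype.card_fin] at h
  rw [← h, inf_comm]

lemma HasBlockBasis.cons_vector [FiniteDimensional ℂ V] {T S : V →ₗ[ℂ] V} {W : Submodule ℂ V}
    {x : V} {l : ℂ} (hxW : x ∈ W) (hx : IsReducingVector T S l x)
    (h : HasBlockBasis T (W ⊓ (Submodule.span ℂ (Set.range ![x]))ᗮ)) : HasBlockBasis T W := by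
  obtain ⟨p, q, b, lam, r, ν, hb, hbW, hd, hr, hν, h1, h2, h3⟩ := h
  have hv : Orthonormal ℂ ![x] := by
    refine ⟨by simpa using hx.1, fun i j hij => absurd (Subsingleton.elim i j) hij⟩
  have hxb : ∀ i, inner ℂ x (b i) = 0 := fun i =>
    (hbW i).2 _ (Submodule.subset_span ⟨0, rfl⟩)
  have hbx : ∀ i, inner ℂ (b i) x = 0 := fun i => inner_eq_zero_symm.mp (hxb i)
  refine ⟨p + 1, q, Sum.elim (Fin.cons x fun i => b (.inl i)) (fun k => b (.inr k)),
    Fin.cons l lam, r, ν, ⟨?_, ?_⟩, ?_, ?_, hr, hν, ?_, h2, h3⟩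
  · rintro (i | k)
    · induction i using Fin.cases with
      | zero => exact hx.1
      | succ i => exact hb.1 _
    · exact hb.1 _
  · rintro (i | k) (j | m) hij
    · induction i using Fin.cases with
      | zero =>
        induction j using Fin.cases with
        | zero => exact absurd rfl hij
        | succ j => exact hxb _
      | succ i =>
        induction j using Fin.cases with
        | zero => exact hbx _
        | succ j => exact hb.2 fun h => hij (by simpa using h)
    · induction i using Fin.cases with
      | zero => exact hxb _
      | succ i => exact hb.2 (by simp)
    · induction j using Fin.cases with
      | zero => exact hbx _
      | succ j => exact hb.2 (by simp)
    · exact hb.2 fun h => hij (by simpa using h)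
  · rintro (i | k)
    · induction i using Fin.cases with
      | zero => exact hxW
      | succ i => exact (hbW _).1
    · exact (hbW _).1
  · rw [finrank_eq_card_add_inf_orthogonal hv (by simpa using hxW), hd]; ring
  · intro i
    induction i using Fin.cases with
    | zero => exact hx.2.1
    | succ i => exact h1 i

lemma HasBlockBasis.cons_pair [FiniteDimensional ℂ V] {T S : V →ₗ[ℂ] V} {W : Submodule ℂ V}
    {x y : V} {s : ℝ} {l : ℂ} (hxW : x ∈ W) (hyW : y ∈ W) (hs : 0 < s)
    (hl : 0 < l.re ∨ (l.re = 0 ∧ 0 ≤ l.im)) (hx : IsReducingPair T S l s x y)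
    (h : HasBlockBasis T (W ⊓ (Submodule.span ℂ (Set.range ![x, y]))ᗮ)) :
    HasBlockBasis T W := by
  obtain ⟨p, q, b, lam, r, ν, hb, hbW, hd, hr, hν, h1, h2, h3⟩ := h
  obtain ⟨hx1, hy1, hxy, hTx, hTy, -, -⟩ := hx
  have hv : Orthonormal ℂ ![x, y] := by
    refine ⟨fun i => by fin_cases i <;> assumption, fun i j hij => ?_⟩
    fin_cases i <;> fin_cases j <;>
      first
      | exact absurd rfl hij
      | exact hxy
      | exact inner_eq_zero_symm.mp hxy
  have hvb : ∀ a i, inner ℂ (![x, y] a) (b i) = 0 := fun a i =>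
    (hbW i).2 _ (Submodule.subset_span ⟨a, rfl⟩)
  have hbv : ∀ a i, inner ℂ (b i) (![x, y] a) = 0 := fun a i => inner_eq_zero_symm.mp (hvb a i)
  have hvW : ∀ a, ![x, y] a ∈ W := fun a => by fin_cases a <;> assumption
  refine ⟨p, q + 1, Sum.elim (fun i => b (.inl i))
    (fun k => Fin.cons (α := fun _ => V) (![x, y] k.1) (fun j => b (.inr (k.1, j))) k.2),
    lam, Fin.cons s r, Fin.cons l ν, ⟨?_, ?_⟩, ?_, ?_, ?_, ?_, h1, ?_, ?_⟩
  · rintro (i | ⟨a, j⟩)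
    · exact hb.1 _
    · induction j using Fin.cases with
      | zero => exact hv.1 a
      | succ j => exact hb.1 _
  · rintro (i | ⟨a, j⟩) (i' | ⟨a', j'⟩) hij
    · exact hb.2 fun h => hij (by simpa using h)
    · induction j' using Fin.cases with
      | zero => exact hbv _ _
      | succ j' => exact hb.2 (by simp)
    · induction j using Fin.cases with
      | zero => exact hvb _ _
      | succ j => exact hb.2 (by simp)
    · induction j using Fin.cases with
      | zero =>
        induction j' using Fin.cases with
        | zero => exact hv.2 fun h => hij (by rw [h])
        | succ j' => exact hvb _ _
      | succ j =>
        induction j' using Fin.cases with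
        | zero => exact hbv _ _
        | succ j' => exact hb.2 fun h => hij (by simpa using h)
  · rintro (i | ⟨a, j⟩)
    · exact (hbW _).1
    · induction j using Fin.cases with
      | zero => exact hvW a
      | succ j => exact (hbW _).1
  · rw [finrank_eq_card_add_inf_orthogonal hv hvW, hd]; ring
  · exact Fin.cases hs hr
  · exact Fin.cases hl hν
  · exact Fin.cases hTx h2
  · exact Fin.cases hTy h3

theorem hasBlockBasis_of_invariant [FiniteDimensional ℂ V] {T S : V →ₗ[ℂ] V}
    (hadj : ∀ x y, inner ℂ (S x) y = inner ℂ x (T y))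
    (hN : ∀ x, T (T (S (S x))) = S (S (T (T x)))) (W : Submodule ℂ V)
    (hT : ∀ x ∈ W, T x ∈ W) (hS : ∀ x ∈ W, S x ∈ W) : HasBlockBasis T W := by
  have hadj' : ∀ x y, inner ℂ (T x) y = inner ℂ x (S y) := fun x y => by
    rw [← inner_conj_symm, ← hadj, inner_conj_symm]
  have span_inv : ∀ {m : ℕ} {v : Fin m → V} {f : V →ₗ[ℂ] V},
      (∀ i, f (v i) ∈ Submodule.span ℂ (Set.range v)) →
      ∀ x ∈ Submodule.span ℂ (Set.range v), f x ∈ Submodule.span ℂ (Set.range v) :=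
    fun {m v f} h x hx => (Submodule.span_le.mpr (Set.range_subset_iff.mpr h) :
      _ ≤ (Submodule.span ℂ (Set.range v)).comap f) hx
  induction hd : Module.finrank ℂ W using Nat.strong_induction_on generalizing W with
  | _ d ih =>
  subst hd
  have key : ∀ {m : ℕ} {v : Fin (m + 1) → V}, (∀ i, v i ∈ W) → Orthonormal ℂ v →
      (∀ i, T (v i) ∈ Submodule.span ℂ (Set.range v)) →
      (∀ i, S (v i) ∈ Submodule.span ℂ (Set.range v)) →
      HasBlockBasis T (W ⊓ (Submodule.span ℂ (Set.range v))ᗮ) := fun hvW hv h1 h2 =>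
    ih _ (by rw [finrank_eq_card_add_inf_orthogonal hv hvW]; omega) _
      (map_mem_inf_orthogonal hadj hT (span_inv h2))
      (map_mem_inf_orthogonal hadj' hS (span_inv h1)) rfl
  by_cases hW : W = ⊥
  · subst hW
    exact ⟨0, 0, fun i => 0, fun _ => 0, fun _ => 0, fun _ => 0,
      ⟨fun i => isEmptyElim i, fun i => isEmptyElim i⟩, fun i => isEmptyElim i, by simp,
      fun i => isEmptyElim i, fun i => isEmptyElim i, fun i => isEmptyElim i,
      fun i => isEmptyElim i, fun i => isEmptyElim i⟩
  rcases exists_reducing hadj hN hT hS hW with ⟨x, hxW, l, hx⟩ | ⟨x, hxW, y, hyW, ν, r, hr, hν, h⟩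
  · refine HasBlockBasis.cons_vector hxW hx (key (by simpa using hxW) ?_ ?_ ?_)
    · exact ⟨by simpa using hx.1,
        fun i j hij => absurd (Subsingleton.elim (α := Fin 1) i j) hij⟩
    · intro i
      have hm : x ∈ Submodule.span ℂ (Set.range ![x]) := Submodule.subset_span ⟨0, rfl⟩
      fin_cases i
      change T x ∈ _
      rw [hx.2.1]
      exact Submodule.smul_mem _ _ hm
    · intro i
      have hm : x ∈ Submodule.span ℂ (Set.range ![x]) := Submodule.subset_span ⟨0, rfl⟩
      fin_cases i
      change S x ∈ _
      rw [hx.2.2]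
      exact Submodule.smul_mem _ _ hm
  · refine HasBlockBasis.cons_pair hxW hyW hr hν h ?_
    obtain ⟨hx1, hy1, hxy, hTx, hTy, hSx, hSy⟩ := h
    have hmx : x ∈ Submodule.span ℂ (Set.range ![x, y]) := Submodule.subset_span ⟨0, rfl⟩
    have hmy : y ∈ Submodule.span ℂ (Set.range ![x, y]) := Submodule.subset_span ⟨1, rfl⟩
    refine key (fun a => by fin_cases a <;> assumption) ?_ ?_ ?_
    · refine ⟨fun i => by fin_cases i <;> assumption, fun i j hij => ?_⟩
      fin_cases i <;> fin_cases j <;>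
        first
        | exact absurd rfl hij
        | exact hxy
        | exact inner_eq_zero_symm.mp hxy
    · intro i
      fin_cases i
      · change T x ∈ _
        rw [hTx]
        exact Submodule.smul_mem _ _ hmx
      · change T y ∈ _
        rw [hTy]
        exact Submodule.sub_mem _ (Submodule.smul_mem _ _ hmx) (Submodule.smul_mem _ _ hmy)
    · intro i
      fin_cases i
      · change S x ∈ _
        rw [hSx]
        exact Submodule.add_mem _ (Submodule.smul_mem _ _ hmy) (Submodule.smul_mem _ _ hmx)
      · change S y ∈ _
        rw [hSy]
        exact Submodule.neg_mem _ (Submodule.smul_mem _ _ hmy)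

end ReducingSubspaces

/-- The block diagonal matrix with blocks `[λ]` and `[[ν, r], [0, -ν]]`. -/
def blockForm {p q : ℕ} (lam : Fin p → ℂ) (r : Fin q → ℝ) (ν : Fin q → ℂ) :
    Matrix (Fin p ⊕ Fin 2 × Fin q) (Fin p ⊕ Fin 2 × Fin q) ℂ :=
  Matrix.fromBlocks (Matrix.diagonal lam) 0 0
    (Matrix.blockDiagonal fun j => !![ν j, (r j : ℂ); 0, -ν j])

lemma blockForm_mul_self {p q : ℕ} (lam : Fin p → ℂ) (r : Fin q → ℝ) (ν : Fin q → ℂ) :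
    blockForm lam r ν * blockForm lam r ν =
      Matrix.diagonal (Sum.elim (fun i => lam i * lam i) fun k => ν k.2 * ν k.2) := by
  have h : ∀ j, !![ν j, (r j : ℂ); 0, -ν j] * !![ν j, (r j : ℂ); 0, -ν j] =
      Matrix.diagonal fun _ => ν j * ν j := fun j => by
    ext a b
    fin_cases a <;> fin_cases b <;> simp [Matrix.mul_apply, Fin.sum_univ_two]
    ring
  rw [blockForm, Matrix.fromBlocks_multiply, ← Matrix.blockDiagonal_mul]
  simp only [h, Matrix.blockDiagonal_diagonal, Matrix.diagonal_mul_diagonal, Matrix.mul_zero,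
    Matrix.zero_mul, add_zero, zero_add, Matrix.fromBlocks_diagonal]

lemma normal_sq_of_eq_conj_blockForm {n p q : ℕ} {A U : Matrix (Fin n) (Fin n) ℂ}
    {e : (Fin p ⊕ Fin 2 × Fin q) ≃ Fin n} {lam : Fin p → ℂ} {r : Fin q → ℝ} {ν : Fin q → ℂ}
    (hU : Uᴴ * U = 1) (hA : A = U * (blockForm lam r ν).submatrix e.symm e.symm * Uᴴ) :
    (A * A)ᴴ * (A * A) = (A * A) * (A * A)ᴴ := by
  have conj_mul : ∀ X Y : Matrix (Fin n) (Fin n) ℂ,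
      (U * X * Uᴴ) * (U * Y * Uᴴ) = U * (X * Y) * Uᴴ := fun X Y => by
    calc (U * X * Uᴴ) * (U * Y * Uᴴ) = U * X * (Uᴴ * U) * Y * Uᴴ := by
          simp only [Matrix.mul_assoc]
      _ = _ := by rw [hU]; simp only [Matrix.mul_assoc, Matrix.mul_one]
  have hAA : ∃ d : Fin n → ℂ, A * A = U * Matrix.diagonal d * Uᴴ := by
    refine ⟨(Sum.elim (fun i => lam i * lam i) fun k => ν k.2 * ν k.2) ∘ e.symm, ?_⟩
    rw [hA, conj_mul, Matrix.submatrix_mul_equiv, blockForm_mul_self,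
      Matrix.submatrix_diagonal_equiv]
  obtain ⟨d, hd⟩ := hAA
  have hdH : (A * A)ᴴ = U * Matrix.diagonal (star d) * Uᴴ := by
    rw [hd, Matrix.conjTranspose_mul, Matrix.conjTranspose_mul, Matrix.conjTranspose_conjTranspose,
      Matrix.diagonal_conjTranspose, Matrix.mul_assoc]
  rw [hdH, hd, conj_mul, conj_mul, Matrix.diagonal_mul_diagonal, Matrix.diagonal_mul_diagonal]
  simp only [mul_comm]

lemma hasBlockBasis_toEuclideanLin {n : ℕ} {A : Matrix (Fin n) (Fin n) ℂ}
    (hA : (A * A)ᴴ * (A * A) = (A * A) * (A * A)ᴴ) :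
    HasBlockBasis (Matrix.toEuclideanLin A) ⊤ := by
  refine hasBlockBasis_of_invariant (S := Matrix.toEuclideanLin Aᴴ) (fun x y => ?_) (fun x => ?_)
    ⊤ (fun _ _ => trivial) (fun _ _ => trivial)
  · rw [Matrix.toEuclideanLin_conjTranspose_eq_adjoint, LinearMap.adjoint_inner_left]
  · have h := congrArg (fun M : Matrix (Fin n) (Fin n) ℂ => M *ᵥ (WithLp.ofLp x)) hA
    simp only [Matrix.conjTranspose_mul, ← Matrix.mulVec_mulVec] at h
    simp only [Matrix.toLpLin_apply]
    rw [h]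

lemma exists_unitary_conj_blockForm {n : ℕ} {A : Matrix (Fin n) (Fin n) ℂ}
    (hA : HasBlockBasis (Matrix.toEuclideanLin A) ⊤) :
    ∃ (U : Matrix (Fin n) (Fin n) ℂ) (p q : ℕ) (e : (Fin p ⊕ Fin 2 × Fin q) ≃ Fin n)
      (lam : Fin p → ℂ) (r : Fin q → ℝ) (ν : Fin q → ℂ),
      Uᴴ * U = 1 ∧ (∀ j, 0 < r j) ∧
      (∀ j, 0 < (ν j).re ∨ ((ν j).re = 0 ∧ 0 ≤ (ν j).im)) ∧
      A = U * (blockForm lam r ν).submatrix e.symm e.symm * Uᴴ := by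
  obtain ⟨p, q, b, lam, r, ν, hb, -, hd, hr, hν, h1, h2, h3⟩ := hA
  rw [finrank_top, finrank_euclideanSpace_fin] at hd
  let e : (Fin p ⊕ Fin 2 × Fin q) ≃ Fin n := Fintype.equivFinOfCardEq (by simp [hd])
  let B : Matrix (Fin n) (Fin p ⊕ Fin 2 × Fin q) ℂ := Matrix.of fun i k => b k i
  have hBB : Bᴴ * B = 1 := by
    ext k l
    have h := orthonormal_iff_ite.mp hb k l
    rw [Matrix.one_apply, ← h, Matrix.mul_apply, PiLp.inner_apply]
    simp [B, mul_comm]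
  have hAB : A * B = B * blockForm lam r ν := by
    have hcol : ∀ i k, (A * B) i k = (Matrix.toEuclideanLin A (b k)) i := fun i k => rfl
    ext i k
    rw [hcol]
    rcases k with k | ⟨a, k⟩
    · rw [h1]
      simp [B, blockForm, Matrix.mul_apply, Matrix.diagonal_apply, mul_comm]
    · fin_cases a
      · change (Matrix.toEuclideanLin A (b (.inr (0, k)))) i = _
        rw [h2]
        simp [B, blockForm, Matrix.mul_apply, Matrix.blockDiagonal_apply, Fintype.sum_prod_type,
          mul_comm]
      · change (Matrix.toEuclideanLin A (b (.inr (1, k)))) i = _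
        rw [h3]
        simp [B, blockForm, Matrix.mul_apply, Matrix.blockDiagonal_apply, Fintype.sum_prod_type,
          mul_comm, sub_eq_add_neg]
  let U : Matrix (Fin n) (Fin n) ℂ := B.submatrix id e.symm
  have hU : Uᴴ * U = 1 := by
    rw [Matrix.conjTranspose_submatrix, ← Matrix.submatrix_mul _ _ _ _ _ Function.bijective_id, hBB,
      Matrix.submatrix_one_equiv]
  refine ⟨U, p, q, e, lam, r, ν, hU, hr, hν, ?_⟩
  have hAU : A * U = U * (blockForm lam r ν).submatrix e.symm e.symm := by
    rw [Matrix.submatrix_mul_equiv, ← hAB]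
    rfl
  rw [← hAU, Matrix.mul_assoc, mul_eq_one_comm.mp hU, Matrix.mul_one]

/-- `A²` is normal iff `A` is unitarily *congruent to a block diagonal matrix whose
blocks are `[λ]` with `λ ∈ ℂ`, or upper triangular `[[ν, r],[0, −ν]]` with `r > 0` real
and `ν ∈ D₊ = {z : Re z > 0} ∪ {it : t ≥ 0}`. -/
theorem stmt_7 {n : ℕ} (A : Matrix (Fin n) (Fin n) ℂ) :
    ((A * A)ᴴ * (A * A) = (A * A) * (A * A)ᴴ) ↔
    ∃ (U : Matrix (Fin n) (Fin n) ℂ) (p q : ℕ)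
      (e : (Fin p ⊕ Fin 2 × Fin q) ≃ Fin n)
      (lam : Fin p → ℂ) (r : Fin q → ℝ) (ν : Fin q → ℂ),
      Uᴴ * U = 1 ∧ (∀ j, 0 < r j) ∧
      (∀ j, 0 < (ν j).re ∨ ((ν j).re = 0 ∧ 0 ≤ (ν j).im)) ∧
      A = U * (Matrix.fromBlocks (Matrix.diagonal lam) 0 0
                (Matrix.blockDiagonal fun j =>
                  !![ν j, (r j : ℂ); 0, -ν j])).submatrix e.symm e.symm * Uᴴ := by
  constructor
  · exact fun h => exists_unitary_conj_blockForm (hasBlockBasis_toEuclideanLin h)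
  · rintro ⟨U, p, q, e, lam, r, ν, hU, -, -, hA⟩
    exact normal_sq_of_eq_conj_blockForm hU hA
end

section
/- Let A and B be n×n complex coninvolutory matrices, i.e., conj(A)·A = I and conj(B)·B = I. Then A and B are unitarily congruent if and only if A and B have the same singular values, i.e., A*A and B*B have the same characteristic polynomial. -/
open Matrix

section Coninvolutory

variable {ι : Type*}

theorem conj_map_mul [Fintype ι] (M N : Matrix ι ι ℂ) :
    (M * N).map (starRingEnd ℂ) = M.map (starRingEnd ℂ) * N.map (starRingEnd ℂ) :=
  Matrix.map_mul

theorem conj_map_ofReal_map (M : Matrix ι ι ℝ) :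
    (M.map Complex.ofReal).map (starRingEnd ℂ) = M.map Complex.ofReal := by
  ext i j; simp

theorem conjTranspose_ofReal_map (M : Matrix ι ι ℝ) :
    (M.map Complex.ofReal)ᴴ = Mᵀ.map Complex.ofReal := by
  ext i j; simp

theorem ofReal_map_mul [Fintype ι] (M N : Matrix ι ι ℝ) :
    (M * N).map Complex.ofReal = M.map Complex.ofReal * N.map Complex.ofReal :=
  Matrix.map_mul (f := Complex.ofRealHom)

theorem ofReal_map_one [DecidableEq ι] : (1 : Matrix ι ι ℝ).map Complex.ofReal = 1 :=
  Matrix.map_one _ rfl rfl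

theorem det_conj_map [Fintype ι] [DecidableEq ι] (M : Matrix ι ι ℂ) :
    (M.map (starRingEnd ℂ)).det = starRingEnd ℂ M.det :=
  ((starRingEnd ℂ).map_det M).symm

theorem det_ofReal_map [Fintype ι] [DecidableEq ι] (M : Matrix ι ι ℝ) : (M.map Complex.ofReal).det = M.det :=
  (Complex.ofRealHom.map_det M).symm

variable [Fintype ι] [DecidableEq ι]

/-- A complex affine pencil that is nonsingular somewhere is nonsingular at a real parameter. -/
theorem exists_real_det_add_smul_ne_zero (P Q : Matrix ι ι ℂ) (z : ℂ) (h : (P + z • Q).det ≠ 0) :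
    ∃ t : ℝ, (P + (t : ℂ) • Q).det ≠ 0 := by
  let p : Polynomial ℂ := ((Polynomial.X : Polynomial ℂ) • Q.map Polynomial.C +
    P.map Polynomial.C).det
  have hp (w : ℂ) : p.eval w = (P + w • Q).det := by
    rw [← Polynomial.coe_evalRingHom, RingHom.map_det]
    congr 1
    ext i j
    simp [add_comm, mul_comm w]
  by_contra! hall
  have h0 : p = 0 := by
    refine Polynomial.eq_zero_of_infinite_isRoot p
      ((Set.infinite_range_of_injective Complex.ofReal_injective).mono ?_)
    rintro _ ⟨t, rfl⟩
    exact (hp t).trans (hall t)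
  exact h (by rw [← hp, h0, Polynomial.eval_zero])

/-- The positive square root of a real positive definite matrix, with its commutation property. -/
theorem exists_sqrt_of_posDef (S : Matrix ι ι ℝ) (hS : S.PosDef) :
    ∃ P : Matrix ι ι ℝ, Pᵀ = P ∧ P * P = S ∧ P.det ≠ 0 ∧
      ∀ K, S * K = K * S → P * K = K * P := by
  have hH := hS.1
  let V : Matrix ι ι ℝ := hH.eigenvectorUnitary
  let d := hH.eigenvalues
  have hd (i) : 0 < d i := hS.eigenvalues_pos i
  have hV : Vᵀ * V = 1 := by
    simpa [star_eq_conjTranspose] using Unitary.coe_star_mul_self hH.eigenvectorUnitary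
  have hV' : V * Vᵀ = 1 := mul_eq_one_comm.mp hV
  have hSV : S = V * diagonal d * Vᵀ := by
    have := hH.spectral_theorem
    rw [Unitary.conjStarAlgAut_apply] at this
    simpa [star_eq_conjTranspose] using this
  let E : Matrix ι ι ℝ := diagonal fun i => Real.sqrt (d i)
  have hE : E * E = diagonal d := by
    simp only [E, diagonal_mul_diagonal]
    congr 1
    ext i
    exact Real.mul_self_sqrt (hd i).le
  have hPP : (V * E * Vᵀ) * (V * E * Vᵀ) = S := by
    calc (V * E * Vᵀ) * (V * E * Vᵀ) = V * E * (Vᵀ * V) * E * Vᵀ := by simp only [Matrix.mul_assoc]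
      _ = S := by rw [hV, hSV, ← hE]; simp only [Matrix.mul_assoc, Matrix.mul_one]
  refine ⟨V * E * Vᵀ, ?_, hPP, ?_, fun K hK => ?_⟩
  · simp [E, Matrix.mul_assoc]
  · intro h0
    have := hS.det_pos
    rw [← hPP, det_mul, h0] at this
    simp at this
  · have hcomm : diagonal d * (Vᵀ * K * V) = (Vᵀ * K * V) * diagonal d := by
      calc diagonal d * (Vᵀ * K * V) = (Vᵀ * V) * diagonal d * Vᵀ * K * V := by
            rw [hV, Matrix.one_mul]; simp only [Matrix.mul_assoc]
        _ = Vᵀ * (S * K) * V := by rw [hSV]; simp only [Matrix.mul_assoc]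
        _ = Vᵀ * K * V * diagonal d * (Vᵀ * V) := by
            rw [hK, hSV]; simp only [Matrix.mul_assoc]
        _ = (Vᵀ * K * V) * diagonal d := by rw [hV, Matrix.mul_one]
    have hEcomm : E * (Vᵀ * K * V) = (Vᵀ * K * V) * E := by
      ext i j
      have hij := congrFun (congrFun hcomm i) j
      simp only [E, diagonal_mul, mul_diagonal] at hij ⊢
      rw [mul_comm, mul_eq_mul_left_iff] at hij ⊢
      exact hij.imp_left fun h => by rw [h]
    calc V * E * Vᵀ * K = V * E * Vᵀ * K * (V * Vᵀ) := by rw [hV', Matrix.mul_one]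
      _ = V * (E * (Vᵀ * K * V)) * Vᵀ := by simp only [Matrix.mul_assoc]
      _ = (V * Vᵀ) * K * (V * E * Vᵀ) := by rw [hEcomm]; simp only [Matrix.mul_assoc]
      _ = K * (V * E * Vᵀ) := by rw [hV', Matrix.one_mul]

/-- Similar real skew-symmetric matrices are orthogonally similar. -/
theorem exists_orthogonal_of_skew_similar (K L R : Matrix ι ι ℝ) (hK : Kᵀ = -K) (hL : Lᵀ = -L)
    (hR : R.det ≠ 0) (h : K * R = R * L) :
    ∃ O : Matrix ι ι ℝ, Oᵀ * O = 1 ∧ K * O = O * L := by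
  have hRu : IsUnit R := R.isUnit_iff_isUnit_det.mpr hR.isUnit
  have hS : (Rᵀ * R).PosDef := by
    simpa using PosDef.conjTranspose_mul_self R (mulVec_injective_of_isUnit hRu)
  obtain ⟨P, hPt, hPP, hPdet, hPc⟩ := exists_sqrt_of_posDef _ hS
  have ht : Rᵀ * K = L * Rᵀ := by
    have := congrArg transpose h
    rw [transpose_mul, transpose_mul, hK, hL, Matrix.mul_neg, Matrix.neg_mul] at this
    exact neg_injective this
  have hPL : P * L = L * P := hPc L <| by
    rw [Matrix.mul_assoc, ← h, ← Matrix.mul_assoc, ht, Matrix.mul_assoc]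
  have hP1 : P * P⁻¹ = 1 := mul_nonsing_inv P hPdet.isUnit
  have hP2 : P⁻¹ * P = 1 := nonsing_inv_mul P hPdet.isUnit
  refine ⟨R * P⁻¹, ?_, ?_⟩
  · calc (R * P⁻¹)ᵀ * (R * P⁻¹) = P⁻¹ * (Rᵀ * R) * P⁻¹ := by
          rw [transpose_mul, transpose_nonsing_inv, hPt]; simp only [Matrix.mul_assoc]
      _ = (P⁻¹ * P) * (P * P⁻¹) := by rw [← hPP]; simp only [Matrix.mul_assoc]
      _ = 1 := by rw [hP1, hP2, Matrix.one_mul]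
  · have hPL' : P⁻¹ * L = L * P⁻¹ := by
      calc P⁻¹ * L = P⁻¹ * (L * P) * P⁻¹ := by
            simp only [Matrix.mul_assoc, hP1, Matrix.mul_one]
        _ = (P⁻¹ * P) * L * P⁻¹ := by rw [← hPL]; simp only [Matrix.mul_assoc]
        _ = L * P⁻¹ := by rw [hP2, Matrix.one_mul]
    rw [← Matrix.mul_assoc, h, Matrix.mul_assoc, ← hPL', Matrix.mul_assoc]

/-- Real matrices that are similar over `ℂ` are similar over `ℝ`. -/
theorem exists_real_similar (K L : Matrix ι ι ℝ) (Z : Matrix ι ι ℂ) (hZ : Z.det ≠ 0)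
    (h : K.map Complex.ofReal * Z = Z * L.map Complex.ofReal) :
    ∃ R : Matrix ι ι ℝ, R.det ≠ 0 ∧ K * R = R * L := by
  have hdecomp : Z = (Z.map Complex.re).map Complex.ofReal +
      Complex.I • (Z.map Complex.im).map Complex.ofReal := by
    ext i j
    simp [mul_comm Complex.I, Complex.re_add_im]
  obtain ⟨t, ht⟩ := exists_real_det_add_smul_ne_zero _ _ _ (hdecomp ▸ hZ)
  refine ⟨Z.map Complex.re + t • Z.map Complex.im, ?_, ?_⟩
  · intro h0
    apply ht
    rw [← Complex.ofReal_zero, ← h0, ← det_ofReal_map]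
    congr 1
    ext i j
    simp
  · have hre : K * Z.map Complex.re = Z.map Complex.re * L := by
      ext i j
      simpa [Matrix.mul_apply] using congrArg Complex.re (congrFun (congrFun h i) j)
    have him : K * Z.map Complex.im = Z.map Complex.im * L := by
      ext i j
      simpa [Matrix.mul_apply] using congrArg Complex.im (congrFun (congrFun h i) j)
    rw [Matrix.mul_add, Matrix.add_mul, hre, Matrix.mul_smul, him, Matrix.smul_mul]

/-- Hermitian matrices with the same characteristic polynomial are similar. -/
theorem exists_similar_of_charpoly_eq (H J : Matrix ι ι ℂ) (hH : H.IsHermitian)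
    (hJ : J.IsHermitian) (h : H.charpoly = J.charpoly) :
    ∃ Z : Matrix ι ι ℂ, Z.det ≠ 0 ∧ H * Z = Z * J := by
  have he := (hH.eigenvalues_eq_eigenvalues_iff hJ).mpr h
  let V : Matrix ι ι ℂ := hH.eigenvectorUnitary
  let W : Matrix ι ι ℂ := hJ.eigenvectorUnitary
  let D : Matrix ι ι ℂ := diagonal (RCLike.ofReal ∘ hJ.eigenvalues)
  have hV : star V * V = 1 := Unitary.coe_star_mul_self hH.eigenvectorUnitary
  have hW : star W * W = 1 := Unitary.coe_star_mul_self hJ.eigenvectorUnitary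
  have hHV : H = V * D * star V := by
    have := hH.spectral_theorem
    rwa [Unitary.conjStarAlgAut_apply, he] at this
  have hJW : J = W * D * star W := by
    have := hJ.spectral_theorem
    rwa [Unitary.conjStarAlgAut_apply] at this
  refine ⟨V * star W, ?_, ?_⟩
  · rw [det_mul]
    exact mul_ne_zero (det_ne_zero_of_left_inverse hV) (det_ne_zero_of_right_inverse hW)
  · calc H * (V * star W) = V * D * (star V * V) * star W := by
          rw [hHV]; simp only [Matrix.mul_assoc]
      _ = V * (star W * W) * D * star W := by rw [hV, hW]; simp
      _ = V * star W * J := by rw [hJW]; simp only [Matrix.mul_assoc]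

open ComplexOrder in
/-- A coninvolutory `A` has the form `X * (conj X)⁻¹`, where `X` can be chosen so that the real
part of its Gram matrix is the identity. -/
theorem exists_factor_of_coninvolutory (A : Matrix ι ι ℂ) (hA : A.map (starRingEnd ℂ) * A = 1) :
    ∃ (X : Matrix ι ι ℂ) (K : Matrix ι ι ℝ), X.det ≠ 0 ∧ A * X.map (starRingEnd ℂ) = X ∧
      Kᵀ = -K ∧ Xᴴ * X = 1 + Complex.I • K.map Complex.ofReal := by
  have hA' : A * A.map (starRingEnd ℂ) = 1 := mul_eq_one_comm.mp hA
  obtain ⟨t, ht⟩ := exists_real_det_add_smul_ne_zero (Complex.I • (A - 1)) (A + 1) Complex.I <| by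
    rw [← smul_add, sub_add_add_cancel, ← two_smul ℂ, det_smul, det_smul]
    exact mul_ne_zero (by simp) (mul_ne_zero (by simp) (det_ne_zero_of_left_inverse hA))
  set X := Complex.I • (A - 1) + (t : ℂ) • (A + 1) with hX
  have hAX : A * X.map (starRingEnd ℂ) = X := by
    have hconj : X.map (starRingEnd ℂ) = -Complex.I • (A.map (starRingEnd ℂ) - 1) +
        (t : ℂ) • (A.map (starRingEnd ℂ) + 1) := by
      ext i j
      by_cases hij : i = j <;> simp [hX, hij]
    rw [hconj, Matrix.mul_add, Matrix.mul_smul, Matrix.mul_smul, Matrix.mul_sub, Matrix.mul_add,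
      hA', Matrix.mul_one, hX, neg_smul, ← smul_neg, neg_sub, add_comm 1 A]
  have hXu : IsUnit X := X.isUnit_iff_isUnit_det.mpr ht.isUnit
  have hG : (Xᴴ * X).PosDef := PosDef.conjTranspose_mul_self X (mulVec_injective_of_isUnit hXu)
  set S : Matrix ι ι ℝ := (Xᴴ * X).map Complex.re with hSdef
  set T : Matrix ι ι ℝ := (Xᴴ * X).map Complex.im
  have hGST : Xᴴ * X = S.map Complex.ofReal + Complex.I • T.map Complex.ofReal := by
    ext i j
    simp only [S, T, Matrix.add_apply, Matrix.smul_apply, Matrix.map_apply, smul_eq_mul]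
    rw [mul_comm, Complex.re_add_im]
  have hSt : Sᵀ = S := by
    ext i j
    simpa [hSdef] using congrArg Complex.re (hG.1.apply i j)
  have hTt : Tᵀ = -T := by
    ext i j
    have := congrArg Complex.im (hG.1.apply i j)
    simp only [RCLike.star_def, Complex.conj_im] at this
    simp [T, ← this]
  have hS : S.PosDef := by
    refine PosDef.of_dotProduct_mulVec_pos (by simpa [IsHermitian] using hSt) fun x hx => ?_
    have hx' : (fun i => (x i : ℂ)) ≠ 0 := fun h0 => hx <| by
      ext i; simpa using congrFun h0 i
    have := hG.re_dotProduct_pos hx'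
    simpa [S, dotProduct, mulVec] using this
  obtain ⟨P, hPt, hPP, hPdet, -⟩ := exists_sqrt_of_posDef S hS
  have hP1 : P * P⁻¹ = 1 := mul_nonsing_inv P hPdet.isUnit
  have hP2 : P⁻¹ * P = 1 := nonsing_inv_mul P hPdet.isUnit
  have hPt' : (P⁻¹)ᵀ = P⁻¹ := by rw [transpose_nonsing_inv, hPt]
  refine ⟨X * P⁻¹.map Complex.ofReal, P⁻¹ * T * P⁻¹, ?_, ?_, ?_, ?_⟩
  · rw [det_mul, det_ofReal_map]
    exact mul_ne_zero ht (Complex.ofReal_ne_zero.mpr (det_ne_zero_of_left_inverse hP1))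
  · rw [conj_map_mul, conj_map_ofReal_map, ← Matrix.mul_assoc, hAX]
  · simp [transpose_mul, hPt', hTt, Matrix.mul_assoc]
  · have hPSP : P⁻¹ * S * P⁻¹ = 1 := by
      rw [← hPP, ← Matrix.mul_assoc, hP2, Matrix.one_mul, hP1]
    rw [conjTranspose_mul, conjTranspose_ofReal_map, hPt', Matrix.mul_assoc,
      ← Matrix.mul_assoc Xᴴ, hGST, ← Matrix.mul_assoc, Matrix.mul_add, Matrix.add_mul,
      ← ofReal_map_mul, ← ofReal_map_mul, hPSP, ofReal_map_one, Matrix.mul_smul, Matrix.smul_mul,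
      ← ofReal_map_mul, ← ofReal_map_mul]

/-- With `A * conj X = X` and `Xᴴ * X = 1 + e`, the Cayley transform of `e` is similar to
`Aᴴ * A`. -/
theorem conj_similar_cayley (A X : Matrix ι ι ℂ) (K : Matrix ι ι ℝ) (hX : X.det ≠ 0)
    (hAX : A * X.map (starRingEnd ℂ) = X)
    (hXX : Xᴴ * X = 1 + Complex.I • K.map Complex.ofReal) :
    ∃ N : Matrix ι ι ℂ, Aᴴ * A * X.map (starRingEnd ℂ) = X.map (starRingEnd ℂ) * N ∧
      Complex.I • K.map Complex.ofReal * (N + 1) = N - 1 ∧ (N + 1).det ≠ 0 := by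
  set Y := X.map (starRingEnd ℂ) with hY
  set e := Complex.I • K.map Complex.ofReal with he
  have hYdet : Y.det ≠ 0 := by
    rw [hY, det_conj_map]; simpa using hX
  have hY1 : Y * Y⁻¹ = 1 := mul_nonsing_inv Y hYdet.isUnit
  have hYY : Yᴴ * Y = 1 - e := by
    have h1 : Yᴴ * Y = (Xᴴ * X).map (starRingEnd ℂ) := by
      rw [conj_map_mul]; congr 1
    rw [h1, hXX]
    ext i j
    by_cases hij : i = j <;> simp [he, hij, sub_eq_add_neg]
  have hN : Y * (Y⁻¹ * (Aᴴ * A) * Y) = Aᴴ * A * Y := by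
    rw [← Matrix.mul_assoc, ← Matrix.mul_assoc, hY1, Matrix.one_mul]
  generalize Y⁻¹ * (Aᴴ * A) * Y = N at hN
  have hcay : (1 - e) * N = 1 + e := by
    rw [← hYY, Matrix.mul_assoc, hN, ← hXX, ← hAX, conjTranspose_mul]
    simp only [Matrix.mul_assoc]
  refine ⟨N, hN.symm, ?_, ?_⟩
  · rw [Matrix.sub_mul, Matrix.one_mul] at hcay
    rw [Matrix.mul_add, Matrix.mul_one]
    rw [sub_eq_iff_eq_add] at hcay
    rw [eq_sub_iff_add_eq]
    refine Eq.trans ?_ hcay.symm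
    abel
  · have h2 : (1 - e) * (N + 1) = (2 : ℂ) • 1 := by
      rw [Matrix.mul_add, hcay, Matrix.mul_one, two_smul]
      abel
    intro h0
    have := congrArg det h2
    rw [det_mul, h0, det_smul, mul_zero, det_one, mul_one] at this
    exact pow_ne_zero _ two_ne_zero this.symm

theorem exists_unitary_congruence_of_charpoly_eq (A B : Matrix ι ι ℂ)
    (hA : A.map (starRingEnd ℂ) * A = 1) (hB : B.map (starRingEnd ℂ) * B = 1)
    (h : (Aᴴ * A).charpoly = (Bᴴ * B).charpoly) :
    ∃ U : Matrix ι ι ℂ, Uᴴ * U = 1 ∧ A = U * B * Uᵀ := by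
  obtain ⟨X, K, hXdet, hAX, hK, hXX⟩ := exists_factor_of_coninvolutory A hA
  obtain ⟨Y, L, hYdet, hBY, hL, hYY⟩ := exists_factor_of_coninvolutory B hB
  obtain ⟨M, hM, hKM, -⟩ := conj_similar_cayley A X K hXdet hAX hXX
  obtain ⟨N, hN, hLN, hNdet⟩ := conj_similar_cayley B Y L hYdet hBY hYY
  obtain ⟨Z, hZdet, hZ⟩ := exists_similar_of_charpoly_eq _ _
    (isHermitian_conjTranspose_mul_self A) (isHermitian_conjTranspose_mul_self B) h
  have hY1 : Y * Y⁻¹ = 1 := mul_nonsing_inv Y hYdet.isUnit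
  have hY2 : Y⁻¹ * Y = 1 := nonsing_inv_mul Y hYdet.isUnit
  set X' := X.map (starRingEnd ℂ) with hX'
  set Y' := Y.map (starRingEnd ℂ) with hY'
  have hX'det : X'.det ≠ 0 := by rw [hX', det_conj_map]; simpa using hXdet
  have hY'det : Y'.det ≠ 0 := by rw [hY', det_conj_map]; simpa using hYdet
  have hX1 : X' * X'⁻¹ = 1 := mul_nonsing_inv X' hX'det.isUnit
  have hX2 : X'⁻¹ * X' = 1 := nonsing_inv_mul X' hX'det.isUnit
  have hMX : X'⁻¹ * (Aᴴ * A) = M * X'⁻¹ := by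
    calc X'⁻¹ * (Aᴴ * A) = X'⁻¹ * (Aᴴ * A * X') * X'⁻¹ := by
          simp only [Matrix.mul_assoc, hX1, Matrix.mul_one]
      _ = M * X'⁻¹ := by rw [hM, ← Matrix.mul_assoc, hX2, Matrix.one_mul]
  obtain ⟨W, hW⟩ : ∃ W, W = X'⁻¹ * Z * Y' := ⟨_, rfl⟩
  have hWdet : W.det ≠ 0 := by
    rw [hW, det_mul, det_mul]
    exact mul_ne_zero (mul_ne_zero (det_ne_zero_of_left_inverse hX1) hZdet) hY'det
  have hMW : M * W = W * N := by
    calc M * W = M * X'⁻¹ * Z * Y' := by rw [hW]; simp only [Matrix.mul_assoc]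
      _ = X'⁻¹ * (Aᴴ * A * Z) * Y' := by rw [← hMX]; simp only [Matrix.mul_assoc]
      _ = X'⁻¹ * Z * (Bᴴ * B * Y') := by rw [hZ]; simp only [Matrix.mul_assoc]
      _ = W * N := by rw [hN, hW]; simp only [Matrix.mul_assoc]
  have hKW : K.map Complex.ofReal * W = W * L.map Complex.ofReal := by
    have h1 : Complex.I • K.map Complex.ofReal * W * (N + 1) =
        W * (Complex.I • L.map Complex.ofReal) * (N + 1) := by
      calc Complex.I • K.map Complex.ofReal * W * (N + 1)
          = Complex.I • K.map Complex.ofReal * (M + 1) * W := by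
            rw [Matrix.mul_assoc, Matrix.mul_assoc, Matrix.mul_add W, ← hMW, Matrix.add_mul M,
              Matrix.mul_one, Matrix.one_mul]
        _ = W * (N - 1) := by
            rw [hKM, Matrix.sub_mul, Matrix.mul_sub, hMW, Matrix.mul_one, Matrix.one_mul]
        _ = W * (Complex.I • L.map Complex.ofReal) * (N + 1) := by rw [Matrix.mul_assoc, hLN]
    have hu : IsUnit (N + 1) := (N + 1).isUnit_iff_isUnit_det.mpr hNdet.isUnit
    have h2 := hu.mul_right_cancel h1
    rw [Matrix.smul_mul, Matrix.mul_smul] at h2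
    exact smul_right_injective _ Complex.I_ne_zero h2
  obtain ⟨R, hRdet, hR⟩ := exists_real_similar K L W hWdet hKW
  obtain ⟨O, hO, hKO⟩ := exists_orthogonal_of_skew_similar K L R hK hL hRdet hR
  set Q := O.map Complex.ofReal with hQ
  have hQQ : Qᴴ * Q = 1 := by
    rw [hQ, conjTranspose_ofReal_map, ← ofReal_map_mul, hO, ofReal_map_one]
  have hQX : Qᴴ * (Xᴴ * X) * Q = Yᴴ * Y := by
    rw [hXX, hYY, Matrix.mul_assoc, Matrix.add_mul, Matrix.one_mul, Matrix.smul_mul, hQ,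
      ← ofReal_map_mul, hKO, ofReal_map_mul, ← hQ, ← Matrix.mul_smul, Matrix.mul_add,
      ← Matrix.mul_assoc, hQQ, Matrix.one_mul]
  have hU : (X * Q * Y⁻¹)ᴴ * (X * Q * Y⁻¹) = 1 := by
    calc (X * Q * Y⁻¹)ᴴ * (X * Q * Y⁻¹) = (Y⁻¹)ᴴ * (Qᴴ * (Xᴴ * X) * Q) * Y⁻¹ := by
          simp only [conjTranspose_mul, Matrix.mul_assoc]
      _ = (Y * Y⁻¹)ᴴ * (Y * Y⁻¹) := by
          rw [hQX]; simp only [conjTranspose_mul, Matrix.mul_assoc]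
      _ = 1 := by rw [hY1]; simp
  have hUY : X * Q * Y⁻¹ * Y = X * Q := by
    rw [Matrix.mul_assoc, hY2, Matrix.mul_one]
  generalize X * Q * Y⁻¹ = U at hU hUY
  have hUY' : U.map (starRingEnd ℂ) * Y' = X' * Q := by
    rw [hY', ← conj_map_mul, hUY, conj_map_mul, hQ, conj_map_ofReal_map]
  have hUB : U * B = A * U.map (starRingEnd ℂ) := by
    have hu : IsUnit Y' := Y'.isUnit_iff_isUnit_det.mpr hY'det.isUnit
    apply hu.mul_right_cancel
    rw [Matrix.mul_assoc, hBY, hUY, Matrix.mul_assoc, hUY', ← Matrix.mul_assoc, hAX]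
  refine ⟨U, hU, ?_⟩
  have hUt : U.map (starRingEnd ℂ) * Uᵀ = 1 := by
    have := congrArg transpose (mul_eq_one_comm.mp hU)
    rw [transpose_mul, transpose_one] at this
    exact this
  rw [hUB, Matrix.mul_assoc, hUt, Matrix.mul_one]

theorem charpoly_eq_of_unitary_congruence (B U : Matrix ι ι ℂ) (hU : Uᴴ * U = 1) :
    ((U * B * Uᵀ)ᴴ * (U * B * Uᵀ)).charpoly = (Bᴴ * B).charpoly := by
  have hUt : Uᵀ * Uᵀᴴ = 1 := by
    have := congrArg transpose hU
    rw [transpose_mul, transpose_one] at this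
    exact this
  have h1 : (U * B * Uᵀ)ᴴ * (U * B * Uᵀ) = Uᵀᴴ * (Bᴴ * B * Uᵀ) := by
    calc (U * B * Uᵀ)ᴴ * (U * B * Uᵀ) = Uᵀᴴ * (Bᴴ * (Uᴴ * U) * B * Uᵀ) := by
          simp only [conjTranspose_mul, Matrix.mul_assoc]
      _ = Uᵀᴴ * (Bᴴ * B * Uᵀ) := by rw [hU, Matrix.mul_one]
  rw [h1, charpoly_mul_comm, Matrix.mul_assoc, hUt, Matrix.mul_one]

end Coninvolutory

/-- Two coninvolutory matrices are unitarily congruent iff they have the same singular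
values, i.e. `A*A` and `B*B` have the same characteristic polynomial. -/
theorem stmt_15 {n : ℕ} (A B : Matrix (Fin n) (Fin n) ℂ)
    (hA : A.map (starRingEnd ℂ) * A = 1) (hB : B.map (starRingEnd ℂ) * B = 1) :
    (∃ U : Matrix (Fin n) (Fin n) ℂ, Uᴴ * U = 1 ∧ A = U * B * Uᵀ) ↔
      (Aᴴ * A).charpoly = (Bᴴ * B).charpoly := by
  refine ⟨?_, exists_unitary_congruence_of_charpoly_eq A B hA hB⟩
  rintro ⟨U, hU, rfl⟩
  exact charpoly_eq_of_unitary_congruence B U hU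
end

section
/- Let A and B be n×n complex involutory matrices, i.e., A² = I and B² = I. Then A and B are unitarily *congruent if and only if A and B have the same singular values (i.e., A*A and B*B have the same characteristic polynomial) and the eigenvalue +1 has the same multiplicity for A and for B (equivalently, rank(A − I) = rank(B − I)). -/
open Matrix

namespace Matrix

variable {ι : Type*} [Fintype ι] [DecidableEq ι]

/-- A Hermitian matrix is diagonalized by a unitary matrix. -/
theorem IsHermitian.exists_unitary_eq_conj {H : Matrix ι ι ℂ} (hH : H.IsHermitian) :
    ∃ W ∈ unitaryGroup ι ℂ, H = W * diagonal (fun i => (hH.eigenvalues i : ℂ)) * Wᴴ :=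
  ⟨hH.eigenvectorUnitary, hH.eigenvectorUnitary.2, by
    conv_lhs => rw [hH.spectral_theorem, Unitary.conjStarAlgAut_apply]
    rfl⟩

/-- Hermitian matrices with the same characteristic polynomial are unitarily similar. -/
theorem IsHermitian.exists_unitary_of_charpoly_eq {S T : Matrix ι ι ℂ} (hS : S.IsHermitian)
    (hT : T.IsHermitian) (h : S.charpoly = T.charpoly) :
    ∃ V ∈ unitaryGroup ι ℂ, V * S = T * V := by
  obtain ⟨W, hW, hSW⟩ := hS.exists_unitary_eq_conj
  obtain ⟨Z, hZ, hTZ⟩ := hT.exists_unitary_eq_conj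
  rw [(IsHermitian.eigenvalues_eq_eigenvalues_iff hS hT).2 h] at hSW
  have hW' : Wᴴ * W = 1 := mem_unitaryGroup_iff'.1 hW
  have hZ' : Zᴴ * Z = 1 := mem_unitaryGroup_iff'.1 hZ
  refine ⟨Z * Wᴴ, mul_mem hZ (Unitary.star_mem hW), ?_⟩
  generalize diagonal (fun i => (hT.eigenvalues i : ℂ)) = D at hSW hTZ
  rw [hSW, hTZ]
  calc Z * Wᴴ * (W * D * Wᴴ) = Z * (Wᴴ * W) * D * Wᴴ := by simp only [Matrix.mul_assoc]
    _ = Z * D * (Zᴴ * Z) * Wᴴ := by rw [hW', hZ', Matrix.mul_one, Matrix.mul_one]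
    _ = Z * D * Zᴴ * (Z * Wᴴ) := by simp only [Matrix.mul_assoc]

theorem IsHermitian.eigenvalues_pow_three {S : Matrix ι ι ℂ} (hS : S.IsHermitian)
    (h : S * S * S = S) (i : ι) : hS.eigenvalues i ^ 3 = hS.eigenvalues i := by
  obtain ⟨W, hW, hSW⟩ := hS.exists_unitary_eq_conj
  have hW' : Wᴴ * W = 1 := mem_unitaryGroup_iff'.1 hW
  have key : diagonal (fun i => (hS.eigenvalues i : ℂ)) = Wᴴ * S * W := by
    generalize diagonal (fun i => (hS.eigenvalues i : ℂ)) = D at hSW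
    calc D = (Wᴴ * W) * D * (Wᴴ * W) := by simp [hW']
      _ = Wᴴ * S * W := by rw [hSW]; simp only [Matrix.mul_assoc]
  have hW'' : W * Wᴴ = 1 := mem_unitaryGroup_iff.1 hW
  have cube : (Wᴴ * S * W) * (Wᴴ * S * W) * (Wᴴ * S * W) = Wᴴ * S * W := by
    calc _ = Wᴴ * (S * (W * Wᴴ) * S * (W * Wᴴ) * S) * W := by simp only [Matrix.mul_assoc]
      _ = _ := by rw [hW'', Matrix.mul_one, Matrix.mul_one, h]
  rw [← key, diagonal_mul_diagonal, diagonal_mul_diagonal] at cube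
  have := congrFun (diagonal_injective cube) i
  rw [pow_three']
  exact_mod_cast this

theorem IsHermitian.trace_mul_self {S : Matrix ι ι ℂ} (hS : S.IsHermitian) :
    (S * S).trace = ∑ i, (hS.eigenvalues i : ℂ) ^ 2 := by
  obtain ⟨W, hW, hSW⟩ := hS.exists_unitary_eq_conj
  have hW' : Wᴴ * W = 1 := mem_unitaryGroup_iff'.1 hW
  have : (∑ i, (hS.eigenvalues i : ℂ) ^ 2) = (diagonal (fun i => (hS.eigenvalues i : ℂ)) *
      diagonal (fun i => (hS.eigenvalues i : ℂ))).trace := by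
    simp [trace_diagonal, sq]
  rw [this]
  generalize diagonal (fun i => (hS.eigenvalues i : ℂ)) = D at hSW
  calc (S * S).trace = (W * (D * (Wᴴ * W) * D * Wᴴ)).trace := by
        rw [hSW]; simp only [Matrix.mul_assoc]
    _ = (D * D * (Wᴴ * W)).trace := by
        rw [trace_mul_comm]; simp only [Matrix.mul_assoc, hW', Matrix.mul_one]
    _ = _ := by rw [hW', Matrix.mul_one]

/-- Hermitian matrices whose eigenvalues lie in `{-1, 0, 1}` have the same characteristic
polynomial as soon as they and their squares have the same traces. -/
theorem IsHermitian.charpoly_eq_of_trace_eq {S T : Matrix ι ι ℂ} (hS : S.IsHermitian)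
    (hT : T.IsHermitian) (hS3 : S * S * S = S) (hT3 : T * T * T = T)
    (h1 : S.trace = T.trace) (h2 : (S * S).trace = (T * T).trace) :
    S.charpoly = T.charpoly := by
  have e1 : ∑ i, hS.eigenvalues i = ∑ i, hT.eigenvalues i := by
    rw [hS.trace_eq_sum_eigenvalues, hT.trace_eq_sum_eigenvalues] at h1
    exact_mod_cast h1
  have e2 : ∑ i, hS.eigenvalues i ^ 2 = ∑ i, hT.eigenvalues i ^ 2 := by
    rw [hS.trace_mul_self, hT.trace_mul_self] at h2
    exact_mod_cast h2
  have interp (f : ι → ℝ) (hf : ∀ i, f i ^ 3 = f i) (g : ℝ → ℝ) :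
      ∑ i, g (f i) = g 1 * ((∑ i, f i ^ 2 + ∑ i, f i) / 2)
        + g (-1) * ((∑ i, f i ^ 2 - ∑ i, f i) / 2)
        + g 0 * (Fintype.card ι - ∑ i, f i ^ 2) := by
    have : (Fintype.card ι : ℝ) = ∑ _i : ι, (1 : ℝ) := by simp
    rw [this, ← Finset.sum_add_distrib, ← Finset.sum_sub_distrib, ← Finset.sum_sub_distrib,
      Finset.sum_div, Finset.sum_div, Finset.mul_sum, Finset.mul_sum, Finset.mul_sum,
      ← Finset.sum_add_distrib, ← Finset.sum_add_distrib]
    refine Finset.sum_congr rfl fun i _ => ?_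
    have h : f i * ((f i - 1) * (f i + 1)) = 0 := by linear_combination hf i
    rcases mul_eq_zero.1 h with h | h
    · rw [h]; ring
    rcases mul_eq_zero.1 h with h | h
    · rw [sub_eq_zero.1 h]; ring
    · rw [eq_neg_of_add_eq_zero_left h]; ring
  have count (f : ι → ℝ) (r : ℝ) : ((Finset.univ.val.map f).count r : ℝ)
      = ∑ i, (fun x => if r = x then (1 : ℝ) else 0) (f i) := by
    simp [Multiset.count_map, Finset.card_def]
  have key : Finset.univ.val.map hS.eigenvalues = Finset.univ.val.map hT.eigenvalues := by
    ext r
    have : ((Finset.univ.val.map hS.eigenvalues).count r : ℝ)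
        = (Finset.univ.val.map hT.eigenvalues).count r := by
      rw [count, count, interp _ (hS.eigenvalues_pow_three hS3) fun x => if r = x then 1 else 0,
        interp _ (hT.eigenvalues_pow_three hT3) fun x => if r = x then 1 else 0, e1, e2]
    exact_mod_cast this
  have := congrArg (fun s => (s.map fun x : ℝ => Polynomial.X - Polynomial.C (x : ℂ)).prod) key
  simp only [Multiset.map_map] at this
  rw [hS.charpoly_eq, hT.charpoly_eq]
  exact this

/-- The trace of an involutory matrix is determined by the rank of `A - 1`. -/
theorem trace_eq_card_sub_rank_of_mul_self_eq_one {A : Matrix ι ι ℂ} (hA : A * A = 1) :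
    A.trace = Fintype.card ι - 2 * (A - 1).rank := by
  set P : Matrix ι ι ℂ := (-(1 / 2) : ℂ) • (A - 1) with hP
  have hPP : IsIdempotentElem (toLin' P) := by
    have : P * P = P := by
      simp only [hP, smul_mul_smul_comm, sub_mul, mul_sub, hA, Matrix.one_mul, Matrix.mul_one]
      module
    rw [IsIdempotentElem, Module.End.mul_eq_comp, ← toLin'_mul, this]
  have hrank : P.rank = (A - 1).rank := by
    rw [hP]
    exact rank_smul_of_mem_nonZeroDivisors _ (mem_nonZeroDivisors_of_ne_zero (by norm_num))
  have htr : P.trace = P.rank := by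
    rw [← trace_toLin'_eq, (LinearMap.isProj_range_iff_isIdempotentElem _).2 hPP |>.trace]
    rfl
  have : P.trace = -(1 / 2) * (A.trace - Fintype.card ι) := by
    simp [hP, trace_sub]
  rw [← hrank, ← htr, this]
  ring

theorem star_apply_eq_of_mul_self_eq_one {A : Matrix ι ι ℂ} {d : ι → ℝ} (hA : A * A = 1)
    (hd : Aᴴ * A = diagonal fun i => (d i : ℂ)) (i j : ι) : star (A j i) = d i * A i j := by
  have hstar : Aᴴ = diagonal (fun i => (d i : ℂ)) * A := by
    rw [← hd, Matrix.mul_assoc, hA, Matrix.mul_one]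
  have := congrFun (congrFun hstar i) j
  rwa [conjTranspose_apply, diagonal_mul] at this

theorem mul_eq_one_of_apply_ne_zero {A : Matrix ι ι ℂ} {d : ι → ℝ} (hA : A * A = 1)
    (hd : Aᴴ * A = diagonal fun i => (d i : ℂ)) {i j : ι} (h : A i j ≠ 0) : d i * d j = 1 := by
  have h1 := congrArg star (star_apply_eq_of_mul_self_eq_one hA hd j i)
  rw [star_star, star_mul', star_apply_eq_of_mul_self_eq_one hA hd i j] at h1
  have h2 : ((d i * d j : ℝ) : ℂ) * A i j = 1 * A i j := by
    rw [one_mul]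
    conv_rhs => rw [h1]
    simp
    ring
  exact_mod_cast mul_right_cancel₀ h h2

/-- The diagonal coordinate projection onto the indices satisfying `P`. -/
noncomputable def coordProj {κ : Type*} [DecidableEq κ] (P : κ → Prop) [DecidablePred P] :
    Matrix κ κ ℂ :=
  diagonal fun i => if P i then 1 else 0

theorem conjTranspose_coordProj {κ : Type*} [DecidableEq κ] (P : κ → Prop) [DecidablePred P] :
    (coordProj P)ᴴ = coordProj P := by
  rw [coordProj, diagonal_conjTranspose]
  congr 1
  ext i
  by_cases h : P i <;> simp [h]

theorem coordProj_mul_self (P : ι → Prop) [DecidablePred P] :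
    coordProj P * coordProj P = coordProj P := by
  simp [coordProj]

theorem coordProj_mul_eq_zero {P Q : ι → Prop} [DecidablePred P] [DecidablePred Q]
    (h : ∀ i, P i → ¬ Q i) : coordProj P * coordProj Q = 0 := by
  rw [coordProj, coordProj, diagonal_mul_diagonal, ← diagonal_zero]
  congr 1
  ext i
  by_cases hP : P i
  · simp [h i hP]
  · simp [hP]

theorem coordProj_mul_comm_of {A : Matrix ι ι ℂ} {P Q : ι → Prop} [DecidablePred P]
    [DecidablePred Q] (h : ∀ i j, A i j ≠ 0 → (P i ↔ Q j)) :
    coordProj P * A = A * coordProj Q := by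
  ext i j
  rw [coordProj, coordProj, diagonal_mul, mul_diagonal]
  by_cases hij : A i j = 0
  · simp [hij]
  · simp [h i j hij]

theorem coordProj_lt_add_gt_add_eq {κ : Type*} [DecidableEq κ] (d : κ → ℝ) :
    coordProj (fun i => 1 < d i) + coordProj (fun i => d i < 1) + coordProj (fun i => d i = 1)
      = 1 := by
  rw [coordProj, coordProj, coordProj, diagonal_add, diagonal_add, ← diagonal_one]
  congr 1
  ext i
  rcases lt_trichotomy (d i) 1 with h | h | h
  · simp [h, h.ne, h.le.not_gt]
  · simp [h]
  · simp [h, h.ne', h.le.not_gt]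

/-- Gluing of intertwiners: if the involutions `a` and `b` swap the orthogonal ranges of `p` and `m`
and preserve that of `q`, where `v` intertwines them, then some unitary intertwines `a` and `b`. -/
theorem exists_intertwiner_of_swap {R : Type*} [Ring R] [StarRing R] {a b p m q v : R}
    (ha : a * a = 1) (hb : b * b = 1) (hab : star a * a = star b * b)
    (hp : star p = p) (hm : star m = m) (hq : star q = q)
    (hpp : p * p = p) (hmm : m * m = m) (hqq : q * q = q)
    (hpm : p * m = 0) (hpq : p * q = 0) (hmq : m * q = 0) (hsum : p + m + q = 1)
    (ham : a * m = p * a) (haq : a * q = q * a)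
    (hbp : b * p = m * b)
    (hv : star v * v = 1) (hvq : v * q = q * v) (hva : v * (a * q) = b * q * v) :
    ∃ u : R, star u * u = 1 ∧ u * a = b * u := by
  have hmp : m * p = 0 := by simpa [hp, hm] using congrArg star hpm
  have hqp : q * p = 0 := by simpa [hp, hq] using congrArg star hpq
  have hqm : q * m = 0 := by simpa [hm, hq] using congrArg star hmq
  have hsvq : star v * q = q * star v := by
    simpa [hq] using (congrArg star hvq).symm
  set c := b * a with hc
  have hcc : star c * c = 1 := by
    calc star c * c = star a * (star b * b) * a := by rw [hc, star_mul]; noncomm_ring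
      _ = star (a * a) * (a * a) := by rw [← hab, star_mul]; noncomm_ring
      _ = 1 := by rw [ha, star_one, one_mul]
  have hcm : c * m = m * c := by rw [hc, mul_assoc, ham, ← mul_assoc, hbp, mul_assoc]
  have hscm : star c * m = m * star c := by
    simpa [hm] using (congrArg star hcm).symm
  refine ⟨p + m * c + q * v, ?_, ?_⟩
  · have hstar : star (p + m * c + q * v) = p + star c * m + star v * q := by
      simp [hp, hm, hq]
    calc star (p + m * c + q * v) * (p + m * c + q * v)
        = p * p + (p * m) * c + (p * q) * v
          + (star c * (m * p) + star c * (m * m) * c + star c * (m * q) * v)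
          + (star v * (q * p) + star v * (q * m) * c + star v * (q * q) * v) := by
          rw [hstar]; noncomm_ring
      _ = p + star c * m * c + star v * q * v := by
          simp [hpp, hmm, hqq, hpm, hpq, hmq, hmp, hqp, hqm]
      _ = p + m * (star c * c) + q * (star v * v) := by rw [hscm, hsvq]; noncomm_ring
      _ = 1 := by rw [hcc, hv, mul_one, mul_one, hsum]
  · calc (p + m * c + q * v) * a = p * a + m * b * (a * a) + (v * q) * a := by
          rw [hc, hvq]; noncomm_ring
      _ = a * m + b * p + v * (a * q) := by
          rw [ha, ham, hbp, haq]; noncomm_ring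
      _ = (b * b) * a * m + b * p + b * q * v := by rw [hb, hva, one_mul]
      _ = b * (p + c * m + q * v) := by rw [hc]; noncomm_ring
      _ = b * (p + m * c + q * v) := by rw [hcm]

theorem trace_mul_eq_zero_of_swap {κ : Type*} [Fintype κ] {A p m : Matrix κ κ ℂ}
    (hpp : p * p = p) (hpm : p * m = 0) (h : A * p = m * A) : (A * p).trace = 0 := by
  rw [← hpp, ← Matrix.mul_assoc, h, trace_mul_comm, ← Matrix.mul_assoc, hpm, Matrix.zero_mul,
    trace_zero]

/-- Involutory matrices with equal traces and the same diagonal Gram matrix are unitarily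
similar. -/
theorem exists_intertwiner_of_gram_eq_diagonal {A B : Matrix ι ι ℂ} {d : ι → ℝ}
    (hd0 : ∀ i, 0 ≤ d i) (hA : A * A = 1) (hB : B * B = 1)
    (hdA : Aᴴ * A = diagonal fun i => (d i : ℂ)) (hdB : Bᴴ * B = diagonal fun i => (d i : ℂ))
    (htr : A.trace = B.trace) : ∃ U : Matrix ι ι ℂ, Uᴴ * U = 1 ∧ U * A = B * U := by
  set p := coordProj (fun i => 1 < d i) with hp
  set m := coordProj (fun i => d i < 1) with hm
  set q := coordProj (fun i => d i = 1) with hq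
  have hpm : p * m = 0 := coordProj_mul_eq_zero fun i h => h.le.not_gt
  have hmp : m * p = 0 := coordProj_mul_eq_zero fun i h => h.le.not_gt
  have hpp : p * p = p := coordProj_mul_self _
  have hmm : m * m = m := coordProj_mul_self _
  have hqq : q * q = q := coordProj_mul_self _
  have hsum : p + m + q = 1 := coordProj_lt_add_gt_add_eq d
  have swap {x y : ℝ} (hx : 0 ≤ x) (hy : 0 ≤ y) (h : x * y = 1) : 1 < x ↔ y < 1 := by
    constructor <;> intro h' <;> by_contra! h'' <;> nlinarith
  have comm {C : Matrix ι ι ℂ} (hC : C * C = 1) (hdC : Cᴴ * C = diagonal fun i => (d i : ℂ)) :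
      C * p = m * C ∧ C * m = p * C ∧ C * q = q * C := by
    refine ⟨(coordProj_mul_comm_of fun i j h => ?_).symm,
      (coordProj_mul_comm_of fun i j h => ?_).symm, (coordProj_mul_comm_of fun i j h => ?_).symm⟩
    all_goals have h1 := mul_eq_one_of_apply_ne_zero hC hdC h
    · exact (swap (hd0 j) (hd0 i) (by rwa [mul_comm])).symm
    · exact swap (hd0 i) (hd0 j) h1
    · constructor <;> intro h' <;> simpa [h'] using h1
  obtain ⟨hAp, hAm, hAq⟩ := comm hA hdA
  obtain ⟨hBp, hBm, hBq⟩ := comm hB hdB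
  have herm {C : Matrix ι ι ℂ} (hC : C * C = 1) (hdC : Cᴴ * C = diagonal fun i => (d i : ℂ)) :
      (C * q).IsHermitian := by
    have hCq := (comm hC hdC).2.2
    rw [IsHermitian, conjTranspose_mul, conjTranspose_coordProj, ← hq, hCq]
    ext i j
    rw [hq, coordProj, diagonal_mul, diagonal_mul, conjTranspose_apply,
      star_apply_eq_of_mul_self_eq_one hC hdC]
    by_cases h : d i = 1 <;> simp [h]
  have sq {C : Matrix ι ι ℂ} (hC : C * C = 1) (hCq : C * q = q * C) : C * q * (C * q) = q := by
    calc C * q * (C * q) = C * (q * C) * q := by simp only [Matrix.mul_assoc]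
      _ = (C * C) * (q * q) := by rw [← hCq]; simp only [Matrix.mul_assoc]
      _ = q := by rw [hC, hqq, Matrix.one_mul]
  have cube {C : Matrix ι ι ℂ} (hC : C * C = 1) (hCq : C * q = q * C) :
      C * q * (C * q) * (C * q) = C * q := by
    rw [sq hC hCq, hCq, ← Matrix.mul_assoc, hqq]
  have trq {C : Matrix ι ι ℂ} (hCp : C * p = m * C) (hCm : C * m = p * C) :
      (C * q).trace = C.trace := by
    have : C = C * p + C * m + C * q := by
      rw [← Matrix.mul_add, ← Matrix.mul_add, hsum, Matrix.mul_one]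
    conv_rhs => rw [this]
    rw [trace_add, trace_add, trace_mul_eq_zero_of_swap hpp hpm hCp,
      trace_mul_eq_zero_of_swap hmm hmp hCm, zero_add, zero_add]
  obtain ⟨v, hv, hvAB⟩ := (herm hA hdA).exists_unitary_of_charpoly_eq (herm hB hdB)
    ((herm hA hdA).charpoly_eq_of_trace_eq (herm hB hdB) (cube hA hAq) (cube hB hBq)
      (by rw [trq hAp hAm, trq hBp hBm, htr]) (by rw [sq hA hAq, sq hB hBq]))
  have hvq : v * q = q * v := by
    calc v * q = v * (A * q) * (A * q) := by rw [Matrix.mul_assoc, sq hA hAq]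
      _ = B * q * (B * q) * v := by rw [hvAB, Matrix.mul_assoc, hvAB, ← Matrix.mul_assoc]
      _ = q * v := by rw [sq hB hBq]
  exact exists_intertwiner_of_swap hA hB (hdA.trans hdB.symm) (conjTranspose_coordProj _)
    (conjTranspose_coordProj _) (conjTranspose_coordProj _) hpp hmm hqq hpm
    (coordProj_mul_eq_zero fun i h => h.ne') (coordProj_mul_eq_zero fun i h => h.ne) hsum
    hAm hAq hBp (mem_unitaryGroup_iff'.1 hv) hvq hvAB

open scoped ComplexOrder in
/-- Involutory matrices with the same singular values and the same trace are unitarily similar. -/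
theorem exists_intertwiner_of_charpoly_eq {A B : Matrix ι ι ℂ} (hA : A * A = 1) (hB : B * B = 1)
    (h : (Aᴴ * A).charpoly = (Bᴴ * B).charpoly) (htr : A.trace = B.trace) :
    ∃ U : Matrix ι ι ℂ, Uᴴ * U = 1 ∧ U * A = B * U := by
  have hGA := isHermitian_conjTranspose_mul_self A
  have hGB := isHermitian_conjTranspose_mul_self B
  obtain ⟨W, hW, hAW⟩ := hGA.exists_unitary_eq_conj
  obtain ⟨Z, hZ, hBZ⟩ := hGB.exists_unitary_eq_conj
  rw [← (IsHermitian.eigenvalues_eq_eigenvalues_iff hGA hGB).2 h] at hBZ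
  have hconj {C V : Matrix ι ι ℂ} (hV : V ∈ unitaryGroup ι ℂ) (hC : C * C = 1)
      (hCV : Cᴴ * C = V * diagonal (fun i => (hGA.eigenvalues i : ℂ)) * Vᴴ) :
      (Vᴴ * C * V) * (Vᴴ * C * V) = 1 ∧ (Vᴴ * C * V)ᴴ * (Vᴴ * C * V)
        = diagonal (fun i => (hGA.eigenvalues i : ℂ)) ∧ (Vᴴ * C * V).trace = C.trace := by
    have hV1 : Vᴴ * V = 1 := mem_unitaryGroup_iff'.1 hV
    have hV2 : V * Vᴴ = 1 := mem_unitaryGroup_iff.1 hV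
    generalize diagonal (fun i => (hGA.eigenvalues i : ℂ)) = D at hCV ⊢
    refine ⟨?_, ?_, ?_⟩
    · calc (Vᴴ * C * V) * (Vᴴ * C * V) = Vᴴ * (C * (V * Vᴴ) * C) * V := by
            simp only [Matrix.mul_assoc]
        _ = 1 := by rw [hV2, Matrix.mul_one, hC, Matrix.mul_one, hV1]
    · calc (Vᴴ * C * V)ᴴ * (Vᴴ * C * V) = Vᴴ * (Cᴴ * (V * Vᴴ) * C) * V := by
            simp only [conjTranspose_mul, conjTranspose_conjTranspose, Matrix.mul_assoc]
        _ = (Vᴴ * V) * D * (Vᴴ * V) := by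
            rw [hV2, Matrix.mul_one, hCV]; simp only [Matrix.mul_assoc]
        _ = D := by rw [hV1, Matrix.mul_one, Matrix.one_mul]
    · rw [trace_mul_comm, ← Matrix.mul_assoc, hV2, Matrix.one_mul]
  obtain ⟨hA1, hA2, hA3⟩ := hconj hW hA hAW
  obtain ⟨hB1, hB2, hB3⟩ := hconj hZ hB hBZ
  obtain ⟨U, hU, hUAB⟩ := exists_intertwiner_of_gram_eq_diagonal
    (posSemidef_conjTranspose_mul_self A).eigenvalues_nonneg hA1 hB1 hA2 hB2
    (by rw [hA3, hB3, htr])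
  have hW2 : W * Wᴴ = 1 := mem_unitaryGroup_iff.1 hW
  have hZ2 : Z * Zᴴ = 1 := mem_unitaryGroup_iff.1 hZ
  refine ⟨Z * U * Wᴴ, mem_unitaryGroup_iff'.1 (mul_mem (mul_mem hZ (mem_unitaryGroup_iff'.2 hU))
    (Unitary.star_mem hW)), ?_⟩
  calc Z * U * Wᴴ * A = Z * (U * (Wᴴ * A * W)) * Wᴴ := by
        simp only [Matrix.mul_assoc, hW2, Matrix.mul_one]
    _ = (Z * Zᴴ) * B * (Z * U * Wᴴ) := by rw [hUAB]; simp only [Matrix.mul_assoc]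
    _ = B * (Z * U * Wᴴ) := by rw [hZ2, Matrix.one_mul]

end Matrix

/-- Two involutory matrices are unitarily *congruent iff they have the same singular
values (i.e. `A*A` and `B*B` have the same characteristic polynomial) and the eigenvalue
`+1` has the same multiplicity for both (i.e. `rank (A − I) = rank (B − I)`). -/
theorem stmt_16 {n : ℕ} (A B : Matrix (Fin n) (Fin n) ℂ)
    (hA : A * A = 1) (hB : B * B = 1) :
    (∃ U : Matrix (Fin n) (Fin n) ℂ, Uᴴ * U = 1 ∧ A = U * B * Uᴴ) ↔
      ((Aᴴ * A).charpoly = (Bᴴ * B).charpoly ∧ (A - 1).rank = (B - 1).rank) := by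
  constructor
  · rintro ⟨U, hU, rfl⟩
    have hU' : U * Uᴴ = 1 := mul_eq_one_comm.1 hU
    have hdet : IsUnit U.det := isUnit_det_of_left_inverse hU
    have hdet' : IsUnit (Uᴴ).det := isUnit_det_of_left_inverse hU'
    constructor
    · have : (U * B * Uᴴ)ᴴ * (U * B * Uᴴ) = U * (Bᴴ * B * Uᴴ) := by
        calc _ = U * (Bᴴ * (Uᴴ * U) * B * Uᴴ) := by
              simp only [conjTranspose_mul, conjTranspose_conjTranspose, Matrix.mul_assoc]
          _ = _ := by rw [hU, Matrix.mul_one]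
      rw [this, charpoly_mul_comm, Matrix.mul_assoc, hU, Matrix.mul_one]
    · have : U * B * Uᴴ - 1 = U * (B - 1) * Uᴴ := by
        rw [Matrix.mul_sub, Matrix.sub_mul, Matrix.mul_one, hU']
      rw [this, rank_mul_eq_left_of_isUnit_det _ _ hdet', rank_mul_eq_right_of_isUnit_det _ _ hdet]
  · rintro ⟨h, hrank⟩
    obtain ⟨U, hU, hUAB⟩ := exists_intertwiner_of_charpoly_eq hB hA h.symm (by
      rw [trace_eq_card_sub_rank_of_mul_self_eq_one hA,
        trace_eq_card_sub_rank_of_mul_self_eq_one hB, hrank])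
    refine ⟨U, hU, ?_⟩
    rw [hUAB, Matrix.mul_assoc, mul_eq_one_comm.1 hU, Matrix.mul_one]
end

section
/- Let λ be a given complex number and let A and B be n×n complex matrices with A² = λA and B² = λB. Then: (a) A and B are unitarily *congruent if and only if rank A = rank B and A and B have the same singular values (i.e., A*A and B*B have the same characteristic polynomial). (b) If in addition A ≠ 0 and A ≠ λI, then the spectral norms of A and A − λI are equal. -/
open Matrix

section LambdaProjection

/-- Two linear maps with the same pointwise norms differ by an isometry of the codomain. -/
lemma LinearMap.exists_linearIsometry_comp_eq {𝕜 E V : Type*} [RCLike 𝕜] [AddCommGroup E]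
    [Module 𝕜 E] [NormedAddCommGroup V] [InnerProductSpace 𝕜 V] [FiniteDimensional 𝕜 V]
    (f g : E →ₗ[𝕜] V) (h : ∀ x, ‖f x‖ = ‖g x‖) :
    ∃ W : V →ₗᵢ[𝕜] V, ∀ x, W (f x) = g x := by
  obtain ⟨r, hr⟩ := f.rangeRestrict.exists_rightInverse_of_surjective f.range_rangeRestrict
  have hfr (y : LinearMap.range f) : f (r y) = y := congrArg Subtype.val (LinearMap.congr_fun hr y)
  let L : LinearMap.range f →ₗᵢ[𝕜] V :=
    { toLinearMap := g ∘ₗ r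
      norm_map' := fun y => by simp [← h, hfr] }
  refine ⟨L.extend, fun x => ?_⟩
  rw [show f x = (f.rangeRestrict x : V) from rfl, L.extend_apply]
  change g (r (f.rangeRestrict x)) = g x
  rw [← sub_eq_zero, ← map_sub, ← norm_eq_zero, ← h, map_sub, hfr]
  simp

namespace Matrix

variable {𝕜 m n : Type*} [RCLike 𝕜] [Fintype m] [DecidableEq m] [Fintype n] [DecidableEq n]

lemma norm_toEuclideanLin_eq_of_conjTranspose_mul_self_eq {S T : Matrix n m 𝕜}
    (h : Sᴴ * S = Tᴴ * T) (x : EuclideanSpace 𝕜 m) :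
    ‖toEuclideanLin S x‖ = ‖toEuclideanLin T x‖ := by
  have key (R : Matrix n m 𝕜) :
      inner 𝕜 (toEuclideanLin R x) (toEuclideanLin R x) =
        inner 𝕜 x (toEuclideanLin (Rᴴ * R) x) := by
    rw [← LinearMap.adjoint_inner_right, ← toEuclideanLin_conjTranspose_eq_adjoint]
    simp [toLpLin_apply]
  rw [@norm_eq_sqrt_re_inner 𝕜, @norm_eq_sqrt_re_inner 𝕜, key, key, h]

/-- Matrices with the same Gram matrix differ by a unitary factor. -/
lemma exists_unitary_mul_eq_of_conjTranspose_mul_self_eq {S T : Matrix n m 𝕜}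
    (h : Sᴴ * S = Tᴴ * T) : ∃ U : Matrix n n 𝕜, Uᴴ * U = 1 ∧ U * S = T := by
  obtain ⟨W, hW⟩ := LinearMap.exists_linearIsometry_comp_eq (toEuclideanLin S) (toEuclideanLin T)
    (norm_toEuclideanLin_eq_of_conjTranspose_mul_self_eq h)
  obtain ⟨U, hU⟩ := EquivLike.surjective (toEuclideanCLM (n := n) (𝕜 := 𝕜)) W.toContinuousLinearMap
  have hUx (x : EuclideanSpace 𝕜 n) : toEuclideanCLM (n := n) (𝕜 := 𝕜) U x = W x := by
    rw [hU]; rfl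
  refine ⟨U, ?_, ?_⟩
  · apply EquivLike.injective (toEuclideanCLM (n := n) (𝕜 := 𝕜))
    rw [map_mul, map_one, ← star_eq_conjTranspose, map_star]
    exact (ContinuousLinearMap.norm_map_iff_adjoint_comp_self _).1 fun x => by
      rw [hUx, W.norm_map]
  · apply toEuclideanLin.injective
    ext1 x
    rw [← hW, ← hUx]
    apply WithLp.ofLp_injective
    simp [toLpLin_apply]

/-- Hermitian matrices with the same characteristic polynomial are unitarily similar. -/
lemma IsHermitian.exists_unitary_conj_of_charpoly_eq {H K : Matrix n n 𝕜} (hH : H.IsHermitian)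
    (hK : K.IsHermitian) (h : H.charpoly = K.charpoly) :
    ∃ U : Matrix n n 𝕜, Uᴴ * U = 1 ∧ H = U * K * Uᴴ := by
  have he := (hH.eigenvalues_eq_eigenvalues_iff hK).2 h
  let V := hH.eigenvectorUnitary * star hK.eigenvectorUnitary
  refine ⟨V, Unitary.coe_star_mul_self V, ?_⟩
  have hs : H = Unitary.conjStarAlgAut 𝕜 _ V K := by
    conv_lhs => rw [hH.spectral_theorem, he]
    rw [← hK.conjStarAlgAut_star_eigenvectorUnitary, ← Unitary.conjStarAlgAut_mul_apply]
  rw [Unitary.conjStarAlgAut_apply] at hs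
  exact hs

open scoped ComplexOrder in
/-- The equation `A * A = c • A` passes to any matrix `B` with `A * Aᴴ = B * Bᴴ` as
`B * A = c • A`, since `A` and `B` have the same range. -/
lemma mul_eq_smul_of_mul_conjTranspose_eq {c : 𝕜} {A B : Matrix n n 𝕜} (hB : B * B = c • B)
    (h : A * Aᴴ = B * Bᴴ) : B * A = c • A := by
  have h0 : (B - c • 1) * A = 0 := by
    rw [← mul_self_mul_conjTranspose_eq_zero, h, ← Matrix.mul_assoc, sub_mul, hB]
    simp
  simpa [sub_mul, sub_eq_zero] using h0

lemma exists_unitary_conj_of_mul_conjTranspose_eq {c : 𝕜} {A B : Matrix n n 𝕜}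
    (hA : A * A = c • A) (hB : B * B = c • B) (h : A * Aᴴ = B * Bᴴ) :
    ∃ U : Matrix n n 𝕜, Uᴴ * U = 1 ∧ A = U * B * Uᴴ := by
  have hBA : B * A = A * A := by rw [hA, mul_eq_smul_of_mul_conjTranspose_eq hB h]
  have hBA' : Aᴴ * Bᴴ = Aᴴ * Aᴴ := by rw [← conjTranspose_mul, hBA, conjTranspose_mul]
  obtain ⟨U, hU, hUS⟩ := exists_unitary_mul_eq_of_conjTranspose_mul_self_eq
    (S := fromCols A Bᴴ) (T := fromCols A Aᴴ) (by
      simp only [conjTranspose_fromCols_eq_fromRows_conjTranspose, fromRows_mul_fromCols,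
        conjTranspose_conjTranspose, hBA, hBA', h])
  rw [mul_fromCols] at hUS
  obtain ⟨h1, h2⟩ := fromCols_inj hUS
  refine ⟨U, hU, ?_⟩
  have h3 : B * Uᴴ = A := by simpa using congrArg conjTranspose h2
  rw [Matrix.mul_assoc, h3, h1]

/-- Matrices annihilated by the same polynomial `X ^ 2 - c X` are unitarily similar as soon as
they have the same singular values. -/
lemma exists_unitary_conj_of_charpoly_eq {c : 𝕜} {A B : Matrix n n 𝕜}
    (hA : A * A = c • A) (hB : B * B = c • B) (h : (Aᴴ * A).charpoly = (Bᴴ * B).charpoly) :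
    ∃ U : Matrix n n 𝕜, Uᴴ * U = 1 ∧ A = U * B * Uᴴ := by
  rw [charpoly_mul_comm, charpoly_mul_comm Bᴴ] at h
  obtain ⟨V, hV, hVAB⟩ := (isHermitian_mul_conjTranspose_self A).exists_unitary_conj_of_charpoly_eq
    (isHermitian_mul_conjTranspose_self B) h
  have hcancel (X Y : Matrix n n 𝕜) : V * X * Vᴴ * (V * Y * Vᴴ) = V * (X * Y) * Vᴴ := by
    calc _ = V * X * (Vᴴ * V) * Y * Vᴴ := by simp only [Matrix.mul_assoc]
      _ = _ := by rw [hV]; simp only [Matrix.mul_assoc, Matrix.one_mul]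
  obtain ⟨W, hW, hWAB⟩ := exists_unitary_conj_of_mul_conjTranspose_eq (B := V * B * Vᴴ) hA
    (by rw [hcancel, hB]; simp)
    (by
      have : (V * B * Vᴴ)ᴴ = V * Bᴴ * Vᴴ := by simp [Matrix.mul_assoc]
      rw [this, hcancel, hVAB])
  refine ⟨W * V, ?_, by rw [hWAB]; simp [Matrix.mul_assoc]⟩
  rw [conjTranspose_mul, Matrix.mul_assoc, ← Matrix.mul_assoc Wᴴ, hW, Matrix.one_mul, hV]

lemma rank_and_charpoly_eq_of_unitary_conj {A B U : Matrix n n 𝕜} (hU : Uᴴ * U = 1)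
    (hAB : A = U * B * Uᴴ) :
    A.rank = B.rank ∧ (Aᴴ * A).charpoly = (Bᴴ * B).charpoly := by
  have hU' : U * Uᴴ = 1 := mul_eq_one_comm.1 hU
  have hdet : IsUnit U.det := (isUnit_iff_isUnit_det U).1 (.of_mul_eq_one _ hU')
  have hdet' : IsUnit Uᴴ.det := (isUnit_iff_isUnit_det Uᴴ).1 (.of_mul_eq_one _ hU)
  refine ⟨?_, ?_⟩
  · rw [hAB, rank_mul_eq_left_of_isUnit_det _ _ hdet', rank_mul_eq_right_of_isUnit_det _ _ hdet]
  · have : Aᴴ * A = U * (Bᴴ * B * Uᴴ) := by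
      calc Aᴴ * A = U * Bᴴ * (Uᴴ * U) * B * Uᴴ := by rw [hAB]; simp [Matrix.mul_assoc]
        _ = _ := by rw [hU]; simp [Matrix.mul_assoc]
    rw [this, charpoly_mul_comm, Matrix.mul_assoc, hU, Matrix.mul_one]

end Matrix

namespace ContinuousLinearMap

variable {𝕜 E : Type*} [RCLike 𝕜] [NormedAddCommGroup E] [InnerProductSpace 𝕜 E]

/-- Exchanging the norms of two nonzero vectors without changing their directions keeps the norm
of their sum. -/
lemma norm_div_smul_add_div_smul {u v : E} (hu : u ≠ 0) (hv : v ≠ 0) :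
    ‖((‖v‖ / ‖u‖ : ℝ) : 𝕜) • u + ((‖u‖ / ‖v‖ : ℝ) : 𝕜) • v‖ = ‖u + v‖ := by
  have hu' : ‖u‖ ≠ 0 := norm_ne_zero_iff.2 hu
  have hv' : ‖v‖ ≠ 0 := norm_ne_zero_iff.2 hv
  rw [← sq_eq_sq₀ (norm_nonneg _) (norm_nonneg _), @norm_add_sq 𝕜, @norm_add_sq 𝕜,
    inner_smul_left, inner_smul_right, RCLike.conj_ofReal, ← mul_assoc, ← RCLike.ofReal_mul,
    norm_smul, norm_smul, RCLike.norm_ofReal, RCLike.norm_ofReal,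
    abs_of_nonneg (by positivity), abs_of_nonneg (by positivity), div_mul_div_comm,
    mul_comm ‖v‖, div_self (by positivity), div_mul_cancel₀ _ hu', div_mul_cancel₀ _ hv']
  simp only [RCLike.ofReal_one, one_mul]
  ring

lemma norm_le_norm_sub_smul_one {c : 𝕜} {T : E →L[𝕜] E} (hT : T * T = c • T)
    (hne : T ≠ c • 1) : ‖T‖ ≤ ‖T - c • 1‖ := by
  rcases eq_or_ne c 0 with rfl | hc
  · simp
  have hc' : 0 < ‖c‖ := norm_pos_iff.2 hc
  have hTT (x : E) : T (T x) = c • T x := DFunLike.congr_fun hT x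
  have hS (x : E) : (T - c • 1) x = T x - c • x := rfl
  refine T.opNorm_le_bound (norm_nonneg _) fun x => ?_
  set v := c • x - T x with hv
  have hTv : T v = 0 := by rw [hv, map_sub, map_smul, hTT, sub_self]
  have hadd : T x + v = c • x := by rw [hv]; abel
  rcases eq_or_ne (T x) 0 with hu0 | hu0
  · rw [hu0, norm_zero]; positivity
  rcases eq_or_ne v 0 with hv0 | hv0
  · have hcS : ‖c‖ ≤ ‖T - c • 1‖ := by
      obtain ⟨y, hy⟩ : ∃ y, (T - c • 1) y ≠ 0 := by
        by_contra! h
        exact hne (sub_eq_zero.1 (ContinuousLinearMap.ext h))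
      have hSS : (T - c • 1) ((T - c • 1) y) = -(c • (T - c • 1) y) := by
        simp only [hS, map_sub, map_smul, hTT]
        simp
      have := (T - c • 1).le_opNorm ((T - c • 1) y)
      rw [hSS, norm_neg, norm_smul] at this
      exact le_of_mul_le_mul_right this (norm_pos_iff.2 hy)
    rw [show T x = c • x by rw [← hadd, hv0, add_zero], norm_smul]
    gcongr
  · set w := ((‖v‖ / ‖T x‖ : ℝ) : 𝕜) • T x + ((‖T x‖ / ‖v‖ : ℝ) : 𝕜) • v with hw
    have hSw : (T - c • 1) w = -(c • ((‖T x‖ / ‖v‖ : ℝ) : 𝕜) • v) := by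
      rw [hS, hw, map_add, map_smul, map_smul, hTT, hTv, smul_zero, smul_add, smul_comm _ c (T x)]
      abel
    have hv' : ‖v‖ ≠ 0 := norm_ne_zero_iff.2 hv0
    have := (T - c • 1).le_opNorm w
    rw [hSw, norm_neg, norm_smul, norm_smul, RCLike.norm_ofReal, abs_of_nonneg (by positivity),
      div_mul_cancel₀ _ hv', hw, norm_div_smul_add_div_smul hu0 hv0, hadd, norm_smul,
      mul_left_comm] at this
    exact le_of_mul_le_mul_left this hc'

lemma norm_eq_norm_sub_smul_one {c : 𝕜} {T : E →L[𝕜] E} (hT : T * T = c • T)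
    (h0 : T ≠ 0) (hne : T ≠ c • 1) : ‖T‖ = ‖T - c • 1‖ := by
  refine le_antisymm (norm_le_norm_sub_smul_one hT hne) ?_
  have h := norm_le_norm_sub_smul_one (c := c) (T := c • 1 - T)
    (by
      simp only [sub_mul, mul_sub, hT, smul_mul_assoc, mul_smul_comm, one_mul, mul_one, smul_sub]
      abel)
    (by simpa [sub_eq_self] using h0)
  rwa [sub_sub_cancel_left, norm_neg, norm_sub_rev] at h

end ContinuousLinearMap

end LambdaProjection

/-- λ-projections: if `A² = λA` and `B² = λB`, then (a) `A` and `B` are unitarily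
*congruent iff they have the same rank and the same singular values; (b) if moreover
`A ≠ 0` and `A ≠ λI`, then the spectral norms of `A` and `A − λI` coincide. -/
theorem stmt_17 {n : ℕ} (lam : ℂ) (A B : Matrix (Fin n) (Fin n) ℂ)
    (hA : A * A = lam • A) (hB : B * B = lam • B) :
    ((∃ U : Matrix (Fin n) (Fin n) ℂ, Uᴴ * U = 1 ∧ A = U * B * Uᴴ) ↔
      (A.rank = B.rank ∧ (Aᴴ * A).charpoly = (Bᴴ * B).charpoly)) ∧
    (A ≠ 0 → A ≠ lam • (1 : Matrix (Fin n) (Fin n) ℂ) →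
      ‖Matrix.toEuclideanCLM (𝕜 := ℂ) (n := Fin n) A‖ =
        ‖Matrix.toEuclideanCLM (𝕜 := ℂ) (n := Fin n) (A - lam • 1)‖) := by
  refine ⟨⟨fun ⟨_, hU, hAB⟩ => rank_and_charpoly_eq_of_unitary_conj hU hAB,
    fun h => exists_unitary_conj_of_charpoly_eq hA hB h.2⟩, fun h0 hne => ?_⟩
  have hinj := EquivLike.injective (toEuclideanCLM (n := Fin n) (𝕜 := ℂ))
  rw [map_sub, map_smul, map_one]
  refine ContinuousLinearMap.norm_eq_norm_sub_smul_one ?_ ?_ ?_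
  · rw [← map_mul, hA, map_smul]
  · rwa [Ne, map_eq_zero_iff _ hinj]
  · rw [← map_one (toEuclideanCLM (n := Fin n) (𝕜 := ℂ)), ← map_smul]
    exact fun h => hne (hinj h)
end

section
/- Let A and B be n×n complex matrices whose minimal polynomials both have degree two. Then A and B are unitarily *congruent if and only if A and B have the same eigenvalues counted with multiplicity (i.e., the same characteristic polynomial) and the same singular values (i.e., A*A and B*B have the same characteristic polynomial). -/
open Matrix

theorem Submodule.exists_le_le_finrank_eq {K V : Type*} [Field K] [AddCommGroup V] [Module K V]
    [FiniteDimensional K V] {P Q : Submodule K V} (hPQ : P ≤ Q) {m : ℕ}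
    (hP : Module.finrank K P ≤ m) (hQ : m ≤ Module.finrank K Q) :
    ∃ S : Submodule K V, P ≤ S ∧ S ≤ Q ∧ Module.finrank K S = m := by
  induction m, hP using Nat.le_induction with
  | base => exact ⟨P, le_rfl, hPQ, rfl⟩
  | succ m _ ih =>
    obtain ⟨S, hPS, hSQ, hS⟩ := ih (by omega)
    have hlt : S < Q := lt_of_le_of_ne hSQ (by rintro rfl; omega)
    obtain ⟨x, hxQ, hxS⟩ := SetLike.exists_of_lt hlt
    refine ⟨S ⊔ span K {x}, hPS.trans le_sup_left,
      sup_le hSQ ((span_singleton_le_iff_mem _ _).2 hxQ), ?_⟩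
    rw [finrank_sup_span_singleton hxS, hS]

namespace Matrix

theorem inner_toEuclideanLin_toEuclideanLin {m k : Type*} [Fintype m] [Fintype k]
    [DecidableEq m] [DecidableEq k] (X : Matrix m k ℂ) (v w : EuclideanSpace ℂ k) :
    inner ℂ (toEuclideanLin X v) (toEuclideanLin X w) =
      inner ℂ v (toEuclideanLin (Xᴴ * X) w) := by
  rw [toLpLin_mul 2 2 2, LinearMap.comp_apply, toEuclideanLin_conjTranspose_eq_adjoint,
    LinearMap.adjoint_inner_right]

theorem exists_unitary_mul_eq_of_conjTranspose_mul_self_eq_s18 {m k : Type*} [Fintype m] [Fintype k]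
    [DecidableEq m] [DecidableEq k] {X Y : Matrix m k ℂ} (h : Xᴴ * X = Yᴴ * Y) :
    ∃ W ∈ unitaryGroup m ℂ, X = W * Y := by
  have hnorm (v) : ‖toEuclideanLin X v‖ = ‖toEuclideanLin Y v‖ := by
    rw [@norm_eq_sqrt_re_inner ℂ, @norm_eq_sqrt_re_inner ℂ,
      inner_toEuclideanLin_toEuclideanLin, inner_toEuclideanLin_toEuclideanLin, h]
  obtain ⟨g, hg⟩ := (toEuclideanLin Y).rangeRestrict.exists_rightInverse_of_surjective
    (LinearMap.range_rangeRestrict _)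
  have hg' (y) : toEuclideanLin Y (g y) = y := congrArg Subtype.val (LinearMap.congr_fun hg y)
  let L : LinearMap.range (toEuclideanLin Y) →ₗᵢ[ℂ] EuclideanSpace ℂ m :=
    ⟨toEuclideanLin X ∘ₗ g, fun y => by
      rw [LinearMap.comp_apply, hnorm, hg', Submodule.coe_norm]⟩
  have hL (v) : toEuclideanLin X v = L.extend (toEuclideanLin Y v) := by
    have h1 := L.extend_apply ((toEuclideanLin Y).rangeRestrict v)
    refine Eq.trans ?_ h1.symm
    rw [← sub_eq_zero, ← norm_eq_zero]
    change ‖toEuclideanLin X v - toEuclideanLin X _‖ = 0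
    rw [← map_sub, hnorm, map_sub, hg']
    simp
  refine ⟨toEuclideanLin.symm L.extend.toLinearMap, ?_, ?_⟩
  · rw [mem_unitaryGroup_iff', star_eq_conjTranspose]
    apply toEuclideanLin.injective
    ext1 v
    refine ext_inner_left ℂ fun w => ?_
    rw [← inner_toEuclideanLin_toEuclideanLin, LinearEquiv.apply_symm_apply]
    simp
  · apply toEuclideanLin.injective
    rw [toLpLin_mul 2 2 2, LinearEquiv.apply_symm_apply]
    exact LinearMap.ext hL

theorem IsHermitian.exists_unitary_eq_of_charpoly_eq {k : Type*} [Fintype k] [DecidableEq k]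
    {H K : Matrix k k ℂ} (hH : H.IsHermitian) (hK : K.IsHermitian)
    (h : H.charpoly = K.charpoly) : ∃ V ∈ unitaryGroup k ℂ, H = V * K * Vᴴ := by
  have he := (hH.eigenvalues_eq_eigenvalues_iff hK).2 h
  have h1 := hH.spectral_theorem
  have h2 := hK.conjStarAlgAut_star_eigenvectorUnitary
  rw [he, ← h2, ← Unitary.conjStarAlgAut_mul_apply, Unitary.conjStarAlgAut_apply] at h1
  exact ⟨_, (hH.eigenvectorUnitary * star hK.eigenvectorUnitary).2, h1⟩

theorem exists_unitary_mul_mul_eq_of_charpoly_eq {m k : Type*} [Fintype m] [Fintype k]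
    [DecidableEq m] [DecidableEq k] {X Y : Matrix m k ℂ}
    (h : (Xᴴ * X).charpoly = (Yᴴ * Y).charpoly) :
    ∃ W ∈ unitaryGroup m ℂ, ∃ V ∈ unitaryGroup k ℂ, X = W * Y * Vᴴ := by
  obtain ⟨V, hV, hXY⟩ := IsHermitian.exists_unitary_eq_of_charpoly_eq
    (isHermitian_conjTranspose_mul_self X) (isHermitian_conjTranspose_mul_self Y) h
  have : Xᴴ * X = (Y * Vᴴ)ᴴ * (Y * Vᴴ) := by
    rw [hXY, conjTranspose_mul, conjTranspose_conjTranspose]; simp only [Matrix.mul_assoc]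
  obtain ⟨W, hW, hX⟩ := exists_unitary_mul_eq_of_conjTranspose_mul_self_eq_s18 this
  exact ⟨W, hW, V, hV, by rw [hX, Matrix.mul_assoc]⟩

theorem fromBlocks_smul_one_eq_of_eq_mul_mul {m k : Type*} [Fintype m] [Fintype k]
    [DecidableEq m] [DecidableEq k] (a b : ℂ) {X Y : Matrix m k ℂ} {W : Matrix m m ℂ}
    {V : Matrix k k ℂ} (hW : W ∈ unitaryGroup m ℂ) (hV : V ∈ unitaryGroup k ℂ)
    (h : X = W * Y * Vᴴ) :
    fromBlocks W 0 0 V ∈ unitaryGroup (m ⊕ k) ℂ ∧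
    fromBlocks (a • 1) X 0 (b • 1) =
      fromBlocks W 0 0 V * fromBlocks (a • 1) Y 0 (b • 1) * (fromBlocks W 0 0 V)ᴴ := by
  rw [mem_unitaryGroup_iff, star_eq_conjTranspose] at *
  simp [fromBlocks_conjTranspose, fromBlocks_multiply, hW, hV, h]

theorem eval_charpoly_fromBlocks_smul_one {m k : Type*} [Fintype m] [Fintype k]
    [DecidableEq m] [DecidableEq k] (a b : ℂ) (X : Matrix m k ℂ) {t z : ℂ}
    (hta : t - star a * a ≠ 0) (htz : z * t = (t - star a * a) * (t - star b * b)) :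
    ((fromBlocks (a • 1) X 0 (b • 1))ᴴ * fromBlocks (a • 1) X 0 (b • 1)).charpoly.eval t =
      (t - star a * a) ^ Fintype.card m * ((t / (t - star a * a)) ^ Fintype.card k *
        (Xᴴ * X).charpoly.eval z) := by
  set s := t - star a * a with hs
  have hz : t - star b * b = t / s * z := by field_simp; linear_combination -htz
  have hts : t / s = 1 + s⁻¹ * (star a * a) := by field_simp; rw [hs]; ring
  have hblock : scalar (m ⊕ k) t - (fromBlocks (a • 1) X 0 (b • 1))ᴴ *
      fromBlocks (a • 1) X 0 (b • 1) =
      fromBlocks (s • 1) (-(star a • X)) (-(a • Xᴴ)) ((t - star b * b) • 1 - Xᴴ * X) := by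
    rw [scalar_apply, ← smul_one_eq_diagonal, ← fromBlocks_one, fromBlocks_smul,
      fromBlocks_conjTranspose, fromBlocks_multiply, sub_eq_add_neg,
      fromBlocks_neg, fromBlocks_add, hs]
    simp [sub_smul, smul_smul, mul_comm]
    constructor <;> abel
  let i : Invertible (s • (1 : Matrix m m ℂ)) :=
    ⟨s⁻¹ • 1, by simp [smul_smul, hta], by simp [smul_smul, hta]⟩
  have hinv : ⅟(s • (1 : Matrix m m ℂ)) = s⁻¹ • 1 := rfl
  rw [eval_charpoly, eval_charpoly, hblock, det_fromBlocks₁₁, hinv, det_smul, det_one, mul_one,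
    ← det_smul]
  congr 2
  rw [hz, scalar_apply, ← smul_one_eq_diagonal]
  simp only [smul_sub, smul_smul, hts, Matrix.mul_neg, Matrix.neg_mul, neg_neg, smul_neg,
    Matrix.mul_smul, Matrix.smul_mul, Matrix.mul_one, add_smul, one_smul]
  rw [sub_sub, mul_left_comm]

open Polynomial in
theorem charpoly_conjTranspose_mul_self_eq_of_fromBlocks {m k : Type*} [Fintype m] [Fintype k]
    [DecidableEq m] [DecidableEq k] (a b : ℂ) (X Y : Matrix m k ℂ)
    (h : ((fromBlocks (a • 1) X 0 (b • 1))ᴴ * fromBlocks (a • 1) X 0 (b • 1)).charpoly =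
      ((fromBlocks (a • 1) Y 0 (b • 1))ᴴ * fromBlocks (a • 1) Y 0 (b • 1)).charpoly) :
    (Xᴴ * X).charpoly = (Yᴴ * Y).charpoly := by
  refine eq_of_infinite_eval_eq _ _ (Set.Infinite.mono ?_
    (Set.toFinite {0, -(star a * a + star b * b)}).infinite_compl)
  intro z hz
  simp only [Set.mem_compl_iff, Set.mem_insert_iff, Set.mem_singleton_iff, not_or] at hz
  obtain ⟨hz0, hz1⟩ := hz
  set α := star a * a with hα
  set β := star b * b with hβ
  obtain ⟨t, ht0, ht⟩ : ∃ t : ℂ, t ≠ 0 ∧ z * t = (t - α) * (t - β) := by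
    obtain ⟨d, hd⟩ := IsAlgClosed.exists_pow_nat_eq ((α + β + z) ^ 2 - 4 * (α * β)) two_pos
    by_cases h0 : α + β + z + d = 0
    · refine ⟨(α + β + z - d) / 2, fun h1 => hz1 ?_, by linear_combination (-1 / 4) * hd⟩
      linear_combination h0 / 2 + h1
    · exact ⟨(α + β + z + d) / 2, by simpa using h0, by linear_combination (-1 / 4) * hd⟩
  have hta : t - α ≠ 0 := fun h => by
    rw [h, zero_mul] at ht
    exact (mul_ne_zero hz0 ht0) ht
  have := congrArg (eval t) h
  rw [eval_charpoly_fromBlocks_smul_one a b X hta ht,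
    eval_charpoly_fromBlocks_smul_one a b Y hta ht] at this
  exact mul_left_cancel₀ (pow_ne_zero _ (div_ne_zero ht0 hta))
    (mul_left_cancel₀ (pow_ne_zero _ hta) this)

set_option maxHeartbeats 400000 in
theorem exists_unitary_fromBlocks_eq {m k : Type*} [Fintype m] [Fintype k]
    [DecidableEq m] [DecidableEq k] {a b : ℂ} {T : Matrix (m ⊕ k) (m ⊕ k) ℂ}
    {S : Submodule ℂ (EuclideanSpace ℂ (m ⊕ k))} (hS : Module.finrank ℂ S = Fintype.card m)
    (ha : ∀ v ∈ S, toEuclideanLin T v = a • v) (hb : ∀ v, toEuclideanLin T v - b • v ∈ S) :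
    ∃ U ∈ unitaryGroup (m ⊕ k) ℂ, ∃ X : Matrix m k ℂ,
      T = U * fromBlocks (a • 1) X 0 (b • 1) * Uᴴ := by
  let w : OrthonormalBasis m ℂ S :=
    (stdOrthonormalBasis ℂ S).reindex ((finCongr hS).trans (Fintype.equivFin m).symm)
  have hw : Orthonormal ℂ ((Set.range Sum.inl).domRestrict
      (Sum.elim (fun i => (w i : EuclideanSpace ℂ (m ⊕ k))) fun _ : k => 0)) := by
    have h1 : Orthonormal ℂ (fun i => (w i : EuclideanSpace ℂ (m ⊕ k))) :=
      w.orthonormal.comp_linearIsometry S.subtypeₗᵢ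
    constructor
    · rintro ⟨_, i, rfl⟩
      exact h1.1 i
    · rintro ⟨_, i, rfl⟩ ⟨_, j, rfl⟩ hij
      exact h1.2 (fun h => hij (by rw [h]))
  obtain ⟨e, he⟩ := hw.exists_orthonormalBasis_extension_of_card_eq finrank_euclideanSpace
  have hel (i : m) : e (Sum.inl i) = w i := he _ ⟨i, rfl⟩
  have her (i : k) (v) (hv : v ∈ S) : inner ℂ (e (Sum.inr i)) v = 0 := by
    have h2 := congrArg Subtype.val (w.sum_repr ⟨v, hv⟩)
    rw [← show _ = v from h2, AddSubmonoidClass.coe_finsetSum, inner_sum]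
    refine Finset.sum_eq_zero fun j _ => ?_
    rw [Submodule.coe_smul, inner_smul_right, ← hel, e.inner_eq_ite]
    simp
  let U := (EuclideanSpace.basisFun (m ⊕ k) ℂ).toBasis.toMatrix e.toBasis
  have hU : U ∈ unitaryGroup (m ⊕ k) ℂ :=
    (EuclideanSpace.basisFun _ ℂ).toMatrix_orthonormalBasis_mem_unitary e
  have hUapp (i j) : U i j = e j i := rfl
  have hentry (i j) : (Uᴴ * T * U) i j = inner ℂ (e i) (toEuclideanLin T (e j)) := by
    rw [Matrix.mul_assoc, EuclideanSpace.inner_eq_star_dotProduct, dotProduct_comm]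
    rfl
  have hUU := mem_unitaryGroup_iff.1 hU
  rw [star_eq_conjTranspose] at hUU
  refine ⟨U, hU, (Uᴴ * T * U).toBlocks₁₂, ?_⟩
  have key : fromBlocks (a • 1) (Uᴴ * T * U).toBlocks₁₂ 0 (b • 1) = Uᴴ * T * U := by
    ext (i | i) (j | j)
    · rw [hentry, ha _ (by rw [hel]; exact (w j).2), inner_smul_right, e.inner_eq_ite]
      simp [one_apply]
    · rfl
    · rw [hentry, ha _ (by rw [hel]; exact (w j).2), inner_smul_right, e.inner_eq_ite]
      simp
    · have h3 : inner ℂ (e (Sum.inr i)) (toEuclideanLin T (e (Sum.inr j))) =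
          inner ℂ (e (Sum.inr i)) (b • e (Sum.inr j)) := by
        rw [← sub_eq_zero, ← inner_sub_right, her _ _ (hb _)]
      rw [hentry, h3, inner_smul_right, e.inner_eq_ite]
      simp [one_apply]
  rw [key]
  calc T = (U * Uᴴ) * T * (U * Uᴴ) := by rw [hUU, one_mul, mul_one]
    _ = _ := by simp only [Matrix.mul_assoc]

theorem finrank_ker_toEuclideanLin_sub_smul_one {ι : Type*} [Fintype ι] [DecidableEq ι]
    {a b : ℂ} (hab : a ≠ b) {A : Matrix ι ι ℂ} (hA : (A - a • 1) * (A - b • 1) = 0) :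
    (Module.finrank ℂ (LinearMap.ker (toEuclideanLin (A - a • 1))) : ℂ) =
      (a - b)⁻¹ * (A.trace - b * Fintype.card ι) := by
  have hab' : a - b ≠ 0 := sub_ne_zero.2 hab
  have hproj : LinearMap.IsProj (LinearMap.ker (toEuclideanLin (A - a • 1)))
      (toEuclideanLin ((a - b)⁻¹ • (A - b • 1))) := by
    constructor
    · intro x
      rw [LinearMap.mem_ker, ← LinearMap.comp_apply, ← toLpLin_mul, Matrix.mul_smul, hA]
      simp
    · intro x hx
      have : A - b • 1 = (A - a • 1) + (a - b) • 1 := by rw [sub_smul]; abel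
      rw [LinearMap.mem_ker] at hx
      rw [this, map_smul, map_add, map_smul, LinearMap.smul_apply, LinearMap.add_apply, hx]
      simp [smul_smul, hab']
  rw [← hproj.trace]
  refine (trace_toLin_eq _ (PiLp.basisFun 2 ℂ ι)).trans ?_
  simp

theorem range_le_ker_of_mul_eq_zero {ι : Type*} [Fintype ι] [DecidableEq ι]
    {M N : Matrix ι ι ℂ} (h : M * N = 0) :
    LinearMap.range (toEuclideanLin N) ≤ LinearMap.ker (toEuclideanLin M) := by
  rw [LinearMap.range_le_ker_iff, ← toLpLin_mul, h, map_zero]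

theorem exists_finrank_forall_exists_submodule {ι : Type*} [Fintype ι] [DecidableEq ι] {a b : ℂ}
    {A : Matrix ι ι ℂ} (hA : (A - a • 1) * (A - b • 1) = 0) :
    ∃ m ≤ Fintype.card ι, ∀ {κ : Type*} [Fintype κ] [DecidableEq κ] (T : Matrix κ κ ℂ),
      Fintype.card κ = Fintype.card ι → (T - a • 1) * (T - b • 1) = 0 → T.trace = A.trace →
      ∃ S : Submodule ℂ (EuclideanSpace ℂ κ), Module.finrank ℂ S = m ∧
      LinearMap.range (toEuclideanLin (T - b • 1)) ≤ S ∧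
      S ≤ LinearMap.ker (toEuclideanLin (T - a • 1)) := by
  by_cases hab : a = b
  · subst hab
    refine ⟨Fintype.card ι / 2, Nat.div_le_self _ _, fun {κ} _ _ T hc hT _ => ?_⟩
    have h1 := (toEuclideanLin (T - a • 1)).finrank_range_add_finrank_ker
    have h2 := Submodule.finrank_mono (range_le_ker_of_mul_eq_zero hT)
    rw [finrank_euclideanSpace] at h1
    obtain ⟨S, h3, h4, h5⟩ := Submodule.exists_le_le_finrank_eq (range_le_ker_of_mul_eq_zero hT)
      (m := Fintype.card ι / 2) (by omega) (by omega)
    exact ⟨S, h5, h3, h4⟩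
  · refine ⟨Module.finrank ℂ (LinearMap.ker (toEuclideanLin (A - a • 1))),
      (Submodule.finrank_le _).trans_eq finrank_euclideanSpace, fun {κ} _ _ T hc hT htr => ?_⟩
    refine ⟨_, ?_, range_le_ker_of_mul_eq_zero hT, le_rfl⟩
    have := finrank_ker_toEuclideanLin_sub_smul_one hab hT
    rw [htr, hc, ← finrank_ker_toEuclideanLin_sub_smul_one hab hA] at this
    exact_mod_cast this

theorem isRoot_minpoly_iff_isRoot_charpoly {ι : Type*} [Fintype ι] [DecidableEq ι]
    (A : Matrix ι ι ℂ) (r : ℂ) : (minpoly ℂ A).IsRoot r ↔ A.charpoly.IsRoot r := by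
  rw [← minpoly_toLin', ← Module.End.hasEigenvalue_iff_isRoot,
    Module.End.hasEigenvalue_iff_isRoot_charpoly, charpoly_toLin']

open Polynomial in
theorem exists_minpoly_eq_of_natDegree_eq_two {ι : Type*} [Fintype ι] [DecidableEq ι]
    {A : Matrix ι ι ℂ} (hA : (minpoly ℂ A).natDegree = 2) :
    ∃ a b : ℂ, minpoly ℂ A = (X - C a) * (X - C b) := by
  have hs := IsAlgClosed.splits (minpoly ℂ A)
  have hm := minpoly.monic (Algebra.IsIntegral.isIntegral (R := ℂ) A)
  obtain ⟨a, b, hab⟩ := Multiset.card_eq_two.1 (hs.natDegree_eq_card_roots.symm.trans hA)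
  refine ⟨a, b, ?_⟩
  rw [hs.eq_prod_roots_of_monic hm, hab]
  simp

open Polynomial in
theorem minpoly_eq_of_charpoly_eq_of_natDegree_eq_two {ι : Type*} [Fintype ι] [DecidableEq ι]
    {A B : Matrix ι ι ℂ} (hA : (minpoly ℂ A).natDegree = 2) (hB : (minpoly ℂ B).natDegree = 2)
    (h : A.charpoly = B.charpoly) : minpoly ℂ A = minpoly ℂ B := by
  have hroot (r : ℂ) : (minpoly ℂ A).IsRoot r ↔ (minpoly ℂ B).IsRoot r := by
    rw [isRoot_minpoly_iff_isRoot_charpoly, isRoot_minpoly_iff_isRoot_charpoly, h]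
  obtain ⟨a, b, hab⟩ := exists_minpoly_eq_of_natDegree_eq_two hA
  obtain ⟨c, d, hcd⟩ := exists_minpoly_eq_of_natDegree_eq_two hB
  simp only [hab, hcd, IsRoot, eval_mul, eval_sub, eval_X, eval_C, mul_eq_zero, sub_eq_zero]
    at hroot
  rw [hab, hcd]
  have ha := hroot a
  have hb := hroot b
  have hc := hroot c
  have hd := hroot d
  have : a = c ∧ b = d ∨ a = d ∧ b = c := by grind
  obtain ⟨rfl, rfl⟩ | ⟨rfl, rfl⟩ := this
  · rfl
  · exact mul_comm _ _

theorem charpoly_unitary_conj {ι : Type*} [Fintype ι] [DecidableEq ι] {U : Matrix ι ι ℂ}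
    (hU : Uᴴ * U = 1) (M : Matrix ι ι ℂ) : (U * M * Uᴴ).charpoly = M.charpoly := by
  rw [charpoly_mul_comm, ← Matrix.mul_assoc, hU, one_mul]

theorem conjTranspose_mul_self_unitary_conj {ι : Type*} [Fintype ι] [DecidableEq ι]
    {U : Matrix ι ι ℂ} (hU : Uᴴ * U = 1) (M : Matrix ι ι ℂ) :
    (U * M * Uᴴ)ᴴ * (U * M * Uᴴ) = U * (Mᴴ * M) * Uᴴ := by
  calc _ = U * Mᴴ * (Uᴴ * U) * M * Uᴴ := by
        simp only [conjTranspose_mul, conjTranspose_conjTranspose, Matrix.mul_assoc]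
    _ = _ := by rw [hU, Matrix.mul_one]; simp only [Matrix.mul_assoc]

theorem exists_unitary_fromBlocks_eq_of_range_le_of_le_ker {m k : Type*} [Fintype m] [Fintype k]
    [DecidableEq m] [DecidableEq k] {a b : ℂ} {T : Matrix (m ⊕ k) (m ⊕ k) ℂ}
    {S : Submodule ℂ (EuclideanSpace ℂ (m ⊕ k))} (hS : Module.finrank ℂ S = Fintype.card m)
    (hr : LinearMap.range (toEuclideanLin (T - b • 1)) ≤ S)
    (hk : S ≤ LinearMap.ker (toEuclideanLin (T - a • 1))) :
    ∃ U ∈ unitaryGroup (m ⊕ k) ℂ, ∃ X : Matrix m k ℂ,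
      T = U * fromBlocks (a • 1) X 0 (b • 1) * Uᴴ := by
  refine exists_unitary_fromBlocks_eq hS (fun v hv => ?_) (fun v => ?_)
  · simpa [sub_eq_zero] using LinearMap.mem_ker.1 (hk hv)
  · simpa using hr (LinearMap.mem_range_self _ v)

theorem exists_unitary_conj_of_range_le_of_le_ker {m k : Type*} [Fintype m] [Fintype k]
    [DecidableEq m] [DecidableEq k] {a b : ℂ} {A B : Matrix (m ⊕ k) (m ⊕ k) ℂ}
    {S T : Submodule ℂ (EuclideanSpace ℂ (m ⊕ k))}
    (hS : Module.finrank ℂ S = Fintype.card m) (hT : Module.finrank ℂ T = Fintype.card m)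
    (hAS : LinearMap.range (toEuclideanLin (A - b • 1)) ≤ S)
    (hSA : S ≤ LinearMap.ker (toEuclideanLin (A - a • 1)))
    (hBT : LinearMap.range (toEuclideanLin (B - b • 1)) ≤ T)
    (hTB : T ≤ LinearMap.ker (toEuclideanLin (B - a • 1)))
    (h : (Aᴴ * A).charpoly = (Bᴴ * B).charpoly) :
    ∃ U ∈ unitaryGroup (m ⊕ k) ℂ, A = U * B * Uᴴ := by
  obtain ⟨U, hU, X, hX⟩ := exists_unitary_fromBlocks_eq_of_range_le_of_le_ker hS hAS hSA
  obtain ⟨V, hV, Y, hY⟩ := exists_unitary_fromBlocks_eq_of_range_le_of_le_ker hT hBT hTB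
  have hU' := mem_unitaryGroup_iff'.1 hU
  have hV' := mem_unitaryGroup_iff'.1 hV
  rw [star_eq_conjTranspose] at hU' hV'
  rw [hX, hY, conjTranspose_mul_self_unitary_conj hU', conjTranspose_mul_self_unitary_conj hV',
    charpoly_unitary_conj hU', charpoly_unitary_conj hV'] at h
  obtain ⟨P, hP, Q, hQ, hPQ⟩ := exists_unitary_mul_mul_eq_of_charpoly_eq
    (charpoly_conjTranspose_mul_self_eq_of_fromBlocks a b X Y h)
  obtain ⟨hD, hXY⟩ := fromBlocks_smul_one_eq_of_eq_mul_mul a b hP hQ hPQ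
  set D : Matrix (m ⊕ k) (m ⊕ k) ℂ := fromBlocks P 0 0 Q
  set F : Matrix (m ⊕ k) (m ⊕ k) ℂ := fromBlocks (a • 1) Y 0 (b • 1)
  refine ⟨U * D * Vᴴ, mul_mem (mul_mem hU hD) (Unitary.star_mem hV), ?_⟩
  rw [hX, hXY, hY]
  calc _ = U * D * 1 * F * 1 * Dᴴ * Uᴴ := by simp only [Matrix.mul_assoc, Matrix.mul_one]
    _ = _ := by
      rw [← hV']
      simp only [conjTranspose_mul, conjTranspose_conjTranspose, Matrix.mul_assoc]

end Matrix

/-- Two matrices whose minimal polynomials have degree two are unitarily *congruent iff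
they have the same eigenvalues with multiplicity (same characteristic polynomial) and the
same singular values (`A*A` and `B*B` have the same characteristic polynomial). -/
theorem stmt_18 {n : ℕ} (A B : Matrix (Fin n) (Fin n) ℂ)
    (hA : (minpoly ℂ A).natDegree = 2) (hB : (minpoly ℂ B).natDegree = 2) :
    (∃ U : Matrix (Fin n) (Fin n) ℂ, Uᴴ * U = 1 ∧ A = U * B * Uᴴ) ↔
      (A.charpoly = B.charpoly ∧ (Aᴴ * A).charpoly = (Bᴴ * B).charpoly) := by
  constructor
  · rintro ⟨U, hU, rfl⟩
    rw [conjTranspose_mul_self_unitary_conj hU]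
    exact ⟨charpoly_unitary_conj hU _, charpoly_unitary_conj hU _⟩
  · rintro ⟨h1, h2⟩
    obtain ⟨a, b, hab⟩ := exists_minpoly_eq_of_natDegree_eq_two hA
    have hab' := (minpoly_eq_of_charpoly_eq_of_natDegree_eq_two hA hB h1).symm.trans hab
    have hannih {T : Matrix (Fin n) (Fin n) ℂ}
        (hT : minpoly ℂ T = (Polynomial.X - Polynomial.C a) * (Polynomial.X - Polynomial.C b)) :
        (T - a • 1) * (T - b • 1) = 0 := by
      have := minpoly.aeval ℂ T
      rw [hT] at this
      simpa [Algebra.algebraMap_eq_smul_one] using this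
    obtain ⟨m, hm, hmT⟩ := exists_finrank_forall_exists_submodule (hannih hab)
    rw [Fintype.card_fin] at hm
    let e : Fin n ≃ Fin m ⊕ Fin (n - m) :=
      (finCongr (Nat.add_sub_cancel' hm).symm).trans finSumFinEquiv.symm
    have hsub (T : Matrix (Fin n) (Fin n) ℂ) (c : ℂ) :
        reindex e e T - c • 1 = reindex e e (T - c • 1) := by
      simp [reindex_apply, submatrix_sub, submatrix_smul]
    have hannih' {T : Matrix (Fin n) (Fin n) ℂ} (hT : (T - a • 1) * (T - b • 1) = 0) :
        (reindex e e T - a • 1) * (reindex e e T - b • 1) = 0 := by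
      rw [hsub, hsub, reindex_apply, reindex_apply, submatrix_mul_equiv, hT]
      rfl
    have hself (T : Matrix (Fin n) (Fin n) ℂ) :
        (reindex e e T)ᴴ * reindex e e T = reindex e e (Tᴴ * T) := by
      rw [conjTranspose_reindex, reindex_apply, reindex_apply, submatrix_mul_equiv, reindex_apply]
    have htrace (T : Matrix (Fin n) (Fin n) ℂ) : (reindex e e T).trace = T.trace := by
      rw [trace_eq_neg_charpoly_nextCoeff, charpoly_reindex, ← trace_eq_neg_charpoly_nextCoeff]
    have hAB : B.trace = A.trace := by
      rw [trace_eq_neg_charpoly_nextCoeff, ← h1, ← trace_eq_neg_charpoly_nextCoeff]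
    have hcard := (Fintype.card_congr e).symm
    obtain ⟨S, hS, hAS, hSA⟩ := hmT (reindex e e A) hcard (hannih' (hannih hab)) (htrace A)
    obtain ⟨T, hT, hBT, hTB⟩ := hmT (reindex e e B) hcard (hannih' (hannih hab'))
      ((htrace B).trans hAB)
    obtain ⟨U, hU, hUAB⟩ := exists_unitary_conj_of_range_le_of_le_ker
      (hS.trans (Fintype.card_fin m).symm) (hT.trans (Fintype.card_fin m).symm) hAS hSA hBT hTB
      (by rw [hself, hself, charpoly_reindex, charpoly_reindex, h2])
    have hU' := mem_unitaryGroup_iff'.1 hU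
    rw [star_eq_conjTranspose] at hU'
    refine ⟨U.submatrix e e, ?_, ?_⟩
    · rw [conjTranspose_submatrix, submatrix_mul_equiv, hU', submatrix_one_equiv]
    · have hB' : B = (reindex e e B).submatrix e e := by simp
      rw [hB', conjTranspose_submatrix, submatrix_mul_equiv, submatrix_mul_equiv, ← hUAB]
      simp
end
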